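/- arXiv:1710.06680 — 3 statements merged into one kernel-verified Lean document; each statement's English description precedes it below -/
import Mathlib

section
/- For every integer t ≥ 0 and every t-dominating graph G, there is a split half-graph H with V(H) = V(G) such that the local difference between G and H is at most 646·t⁴. -/
/-- `u` `t`-dominates `v` in `G`: there are at most `t` vertices different from `u, v`
that are adjacent to `v` and not to `u`. -/
def Dominates {V : Type*} (G : SimpleGraph V) (t : ℕ) (u v : V) : Prop :=
  {w : V | w ≠ u ∧ w ≠ v ∧ G.Adj w v ∧ ¬ G.Adj w u}.ncard ≤ t

/-- `G` is `t`-dominating: for every pair of distinct vertices, one `t`-dominates the other. -/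
def IsTDominating {V : Type*} (G : SimpleGraph V) (t : ℕ) : Prop :=
  ∀ u v : V, u ≠ v → Dominates G t u v ∨ Dominates G t v u

/-- `H` is a split half-graph: the vertex set is partitioned into a clique `X` and a stable
set `Y`, and `X` and `Y` can be ordered so that the edges between `X` and `Y` form a
half-graph. -/
def IsSplitHalfGraph {V : Type*} (H : SimpleGraph V) : Prop :=
  ∃ X Y : Set V, (∀ v, v ∈ X ∨ v ∈ Y) ∧ Disjoint X Y ∧
    (∀ x ∈ X, ∀ x' ∈ X, x ≠ x' → H.Adj x x') ∧
    (∀ y ∈ Y, ∀ y' ∈ Y, ¬ H.Adj y y') ∧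
    ∃ f : V → ℕ, Set.InjOn f X ∧ Set.InjOn f Y ∧
      ∀ x ∈ X, ∀ x' ∈ X, ∀ y ∈ Y, ∀ y' ∈ Y,
        f x ≤ f x' → f y ≤ f y' → H.Adj x y → H.Adj x' y'

/-- The local difference between `G` and `H` is at most `d`. -/
def LocalDiffLE {V : Type*} (G H : SimpleGraph V) (d : ℕ) : Prop :=
  ∀ v : V, (G.neighborSet v \ H.neighborSet v).ncard
      + (H.neighborSet v \ G.neighborSet v).ncard ≤ d

section
open Finset Classical

/-! ### Counting lemmas -/

/-- An injective labelling takes at most `b - a` values in `[a, b)`. -/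
lemma card_filter_label_le {α : Type*} [Fintype α] (f : α → ℕ) (hf : Function.Injective f)
    (a b : ℕ) : #{x | a ≤ f x ∧ f x < b} ≤ b - a := by
  rw [← Nat.card_Ico]
  refine card_le_card_of_injOn f (fun x hx => ?_) hf.injOn
  simpa using hx

lemma card_fin_lt {m : ℕ} (p : ℕ) (hp : p ≤ m) : #{x : Fin m | (x : ℕ) < p} = p := by
  rw [Fin.card_filter_val_lt]
  omega

lemma card_filter_equiv {α β : Type*} [Fintype α] [Fintype β] (e : α ≃ β) (P : β → Prop)
    [DecidablePred P] : #{x | P (e x)} = #{y | P y} :=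
  card_equiv e (by simp)

lemma card_filter_rev {n : ℕ} (P : Fin n → Prop) [DecidablePred P] :
    #{j | P (Fin.rev j)} = #{j | P j} :=
  card_filter_equiv Fin.revPerm P

lemma card_and_not_add_card {α : Type*} [Fintype α] (P Q : α → Prop) [DecidablePred P]
    [DecidablePred Q] :
    #{x | P x ∧ ¬ Q x} + #{x | Q x} = #{x | Q x ∧ ¬ P x} + #{x | P x} := by
  have key : ∀ (P Q : α → Prop) [DecidablePred P] [DecidablePred Q],
      #{x | P x ∧ ¬ Q x} + #{x | P x ∧ Q x} = #{x | P x} := by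
    intro P Q _ _
    have h := card_filter_add_card_filter_not (s := ({x | P x} : Finset α)) Q
    simp only [filter_filter] at h
    omega
  have h₁ := key P Q
  have h₂ := key Q P
  have h₃ : #{x | P x ∧ Q x} = #{x | Q x ∧ P x} := by simp only [and_comm]
  omega

/-- In an almost nested family of sets covering every point at most `t` times, at most `t` members
are large. -/
lemma card_large_le {ι ω : Type*} (κ : ι → ℤ) (A : Finset ι) (Z : Finset ω) (Q : ι → ω → Prop)
    [∀ i, DecidablePred (Q i)] (t q : ℕ)
    (hchain : ∀ a ∈ A, ∀ b ∈ A, a ≠ b → κ a ≤ κ b → #{w ∈ Z | Q b w ∧ ¬ Q a w} ≤ q)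
    (hdeg : ∀ w ∈ Z, #{a ∈ A | Q a w} ≤ t) :
    #{a ∈ A | t * q < #{w ∈ Z | Q a w}} ≤ t := by
  by_contra! hlt
  obtain ⟨T, hT, hTc⟩ := exists_subset_card_eq (Nat.succ_le_of_lt hlt)
  have hTne : T.Nonempty := card_pos.1 (by omega)
  obtain ⟨b, hb, hmax⟩ := exists_max_image T κ hTne
  have hbA := mem_filter.1 (hT hb)
  have hU : #((T.erase b).biUnion fun a => {w ∈ Z | Q b w ∧ ¬ Q a w}) ≤ t * q := by
    refine (card_biUnion_le_card_mul _ _ q fun a ha => ?_).trans ?_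
    · have ha' := mem_erase.1 ha
      exact hchain a (mem_filter.1 (hT ha'.2)).1 b hbA.1 ha'.1 (hmax a ha'.2)
    · rw [card_erase_of_mem hb, hTc]
      simp
  obtain ⟨w, hw, hwU⟩ := exists_mem_notMem_of_card_lt_card (hU.trans_lt hbA.2)
  have hw' := mem_filter.1 hw
  have hsub : T ⊆ {a ∈ A | Q a w} := by
    intro a ha
    refine mem_filter.2 ⟨(mem_filter.1 (hT ha)).1, ?_⟩
    by_contra hQ
    have hab : a ≠ b := by
      rintro rfl
      exact hQ hw'.2
    exact hwU (mem_biUnion.2 ⟨a, mem_erase.2 ⟨hab, ha⟩, mem_filter.2 ⟨hw'.1, hw'.2, hQ⟩⟩)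
  have := (card_le_card hsub).trans (hdeg w hw'.1)
  omega

/-- A relation that is sparse seen from one side and dense seen from the other lives on a small
set. -/
lemma card_le_or_card_le {ι κ : Type*} (A : Finset ι) (K : Finset κ) (Q : ι → κ → Prop) (p q : ℕ)
    (hA : ∀ a ∈ A, #{k ∈ K | ¬ Q a k} ≤ p) (hK : ∀ k ∈ K, #{a ∈ A | Q a k} ≤ q) :
    #A ≤ 2 * q ∨ #K ≤ 2 * p := by
  by_contra! h
  have h₁ : ∑ a ∈ A, #{k ∈ K | Q a k} = ∑ k ∈ K, #{a ∈ A | Q a k} :=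
    sum_card_bipartiteAbove_eq_sum_card_bipartiteBelow Q
  have h₂ : ∑ k ∈ K, #{a ∈ A | Q a k} ≤ #K * q := by
    simpa using sum_le_card_nsmul K _ q hK
  have h₃ : ∑ a ∈ A, #{k ∈ K | ¬ Q a k} ≤ #A * p := by
    simpa using sum_le_card_nsmul A _ p hA
  have h₄ : ∑ a ∈ A, #{k ∈ K | Q a k} + ∑ a ∈ A, #{k ∈ K | ¬ Q a k} = #A * #K := by
    rw [← sum_add_distrib, sum_congr rfl fun a _ => card_filter_add_card_filter_not (Q a)]
    simp
  obtain ⟨hq, hp⟩ := h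
  have h₅ : #K * (2 * q) < #K * #A := by
    gcongr
    omega
  have h₆ : #A * (2 * p) < #A * #K := by
    gcongr
    omega
  nlinarith

/-- Every finite type can be listed with a given function decreasing. -/
lemma exists_equiv_fin_antitone {α : Type*} [Fintype α] (f : α → ℕ) :
    ∃ e : Fin (Fintype.card α) ≃ α, ∀ i j, i ≤ j → f (e j) ≤ f (e i) := by
  let e := (Fintype.equivFin α).symm
  let F : Fin (Fintype.card α) → ℕᵒᵈ := fun i => OrderDual.toDual (f (e i))
  refine ⟨(Tuple.sort F).trans e, fun i j hij => ?_⟩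
  exact OrderDual.toDual_le_toDual.1 (Tuple.monotone_sort F hij)

/-- The first failure of `P` in `[lo, hi)`, or `hi` if there is none. -/
lemma exists_first_failure (P : ℕ → Prop) (lo hi : ℕ) (hle : lo ≤ hi) :
    ∃ h, lo ≤ h ∧ h ≤ hi ∧ (∀ j, lo ≤ j → j < h → P j) ∧
      ∀ j, h ≤ j → j < hi → ∃ j', lo ≤ j' ∧ j' ≤ j ∧ ¬ P j' := by
  by_cases hex : ∃ j, lo ≤ j ∧ j < hi ∧ ¬ P j
  · obtain ⟨h₁, h₂, h₃⟩ := Nat.find_spec hex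
    refine ⟨Nat.find hex, h₁, h₂.le, fun j hj hlt => ?_, fun j hj _ => ⟨_, h₁, hj, h₃⟩⟩
    by_contra hP
    exact Nat.find_min hex hlt ⟨hj, hlt.trans h₂, hP⟩
  · push Not at hex
    exact ⟨hi, hle, le_rfl, fun j hj hlt => hex j hj hlt, fun j h₁ h₂ => by omega⟩

/-! ### Almost nested bipartite relations -/

/-- The number of elements related to `i`. -/
noncomputable def relDegree {α β : Type*} [Fintype β] (R : α → β → Prop) (i : α) : ℕ :=
  #{j | R i j}

/-- Rows and columns are listed with decreasing degrees, and every row (column) is contained in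
each earlier one up to `t` elements. -/
structure AlmostNested {m n : ℕ} (R : Fin m → Fin n → Prop) (t : ℕ) : Prop where
  row : ∀ i i', i < i' → #{j | R i' j ∧ ¬ R i j} ≤ t
  col : ∀ j j', j < j' → #{i | R i j' ∧ ¬ R i j} ≤ t
  row_degree : ∀ i i', i ≤ i' → relDegree R i' ≤ relDegree R i
  col_degree : ∀ j j', j ≤ j' → relDegree (Function.swap R) j' ≤ relDegree (Function.swap R) j

/-- Complement a relation and reverse both orders. -/
def compRev {m n : ℕ} (R : Fin m → Fin n → Prop) : Fin m → Fin n → Prop :=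
  fun i j => ¬ R (Fin.rev i) (Fin.rev j)

lemma relDegree_compRev {m n : ℕ} (R : Fin m → Fin n → Prop) (i : Fin m) :
    relDegree (compRev R) i + relDegree R (Fin.rev i) = n := by
  have h : #{j | R (Fin.rev i) j} + #{j | ¬ R (Fin.rev i) j} = #(univ : Finset (Fin n)) :=
    card_filter_add_card_filter_not _
  have h₁ : relDegree (compRev R) i = #{j | ¬ R (Fin.rev i) j} := by
    rw [← card_filter_rev]
    simp only [relDegree, compRev]
    congr
  have h₂ : relDegree R (Fin.rev i) = #{j | R (Fin.rev i) j} := rfl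
  rw [card_univ, Fintype.card_fin] at h
  omega

lemma relDegree_swap_compRev {m n : ℕ} (R : Fin m → Fin n → Prop) (j : Fin n) :
    relDegree (Function.swap (compRev R)) j + relDegree (Function.swap R) (Fin.rev j) = m :=
  relDegree_compRev (Function.swap R) j

namespace AlmostNested

variable {m n t : ℕ} {R : Fin m → Fin n → Prop}

lemma swap (hR : AlmostNested R t) : AlmostNested (Function.swap R) t :=
  ⟨hR.col, hR.row, hR.col_degree, hR.row_degree⟩

lemma card_compRev_row_le (hR : AlmostNested R t) (i i' : Fin m) (h : i < i') :
    #{j | compRev R i' j ∧ ¬ compRev R i j} ≤ t := by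
  have h' := hR.row (Fin.rev i') (Fin.rev i) (Fin.rev_lt_rev.2 h)
  rw [← card_filter_rev] at h'
  simpa [compRev, and_comm] using h'

lemma compRev_degree_le (hR : AlmostNested R t) (i i' : Fin m) (h : i ≤ i') :
    relDegree (compRev R) i' ≤ relDegree (compRev R) i := by
  have h₁ := relDegree_compRev R i
  have h₂ := relDegree_compRev R i'
  have h₃ := hR.row_degree _ _ (Fin.rev_le_rev.2 h)
  omega

lemma compRev (hR : AlmostNested R t) : AlmostNested (compRev R) t :=
  ⟨hR.card_compRev_row_le, hR.swap.card_compRev_row_le, hR.compRev_degree_le,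
    hR.swap.compRev_degree_le⟩

lemma card_nonadj_le (hR : AlmostNested R t) (i : Fin m) :
    #{j | ¬ R i j ∧ i + t * t < relDegree (Function.swap R) j} ≤ t := by
  refine le_trans (card_le_card ?_) (card_large_le (fun j : Fin n => ((j : ℕ) : ℤ)) {j | ¬ R i j}
    {w | i < w} (fun j w => R w j) t t ?_ ?_)
  · intro j hj
    simp only [mem_filter, mem_univ, true_and] at hj ⊢
    refine ⟨hj.1, ?_⟩
    have hsub : ({w | R w j} : Finset (Fin m)) ⊆
        ({w | (w : ℕ) < i} : Finset (Fin m)) ∪ ({w ∈ {w | i < w} | R w j} : Finset (Fin m)) := by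
      intro w hw
      simp only [mem_filter, mem_univ, true_and, mem_union] at hw ⊢
      rcases lt_trichotomy w i with h | h | h
      · exact .inl h
      · subst h
        exact absurd hw hj.1
      · exact .inr ⟨h, hw⟩
    have h₁ := (card_le_card hsub).trans (card_union_le _ _)
    rw [card_fin_lt _ i.2.le] at h₁
    have h₂ : relDegree (Function.swap R) j = #{w | R w j} := rfl
    omega
  · intro a _ b _ hab hle
    refine (card_le_card ?_).trans (hR.col a b (by
      simp only [Nat.cast_le, Fin.val_fin_le] at hle
      exact lt_of_le_of_ne hle hab))
    intro w hw
    simp only [mem_filter, mem_univ, true_and] at hw ⊢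
    exact hw.2
  · intro w hw
    refine (card_le_card ?_).trans (hR.row i w (by simpa using hw))
    intro j hj
    simp only [mem_filter, mem_univ, true_and] at hj ⊢
    exact hj.symm

lemma card_adj_le (hR : AlmostNested R t) (i : Fin m) :
    #{j | R i j ∧ relDegree (Function.swap R) j + t * t ≤ i} ≤ t := by
  have h := hR.compRev.card_nonadj_le (Fin.rev i)
  rw [← card_filter_rev] at h
  refine (card_le_card ?_).trans h
  intro j hj
  simp only [mem_filter, mem_univ, true_and] at hj ⊢
  have h₁ := relDegree_swap_compRev R (Fin.rev j)
  have h₂ := Fin.val_rev i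
  have h₃ := i.2
  rw [Fin.rev_rev] at h₁
  refine ⟨by simpa [_root_.compRev] using hj.1, ?_⟩
  omega

/-- Rows of similar degree are contained in each other up to few elements. -/
lemma card_diff_le (hR : AlmostNested R t) (i i' : Fin m) (d : ℕ)
    (hd : relDegree R i' ≤ relDegree R i + d) : #{j | R i' j ∧ ¬ R i j} ≤ t + d := by
  rcases lt_trichotomy i i' with h | h | h
  · exact (hR.row i i' h).trans (by omega)
  · subst h
    simp
  · have h₁ := hR.row i' i h
    have h₂ := card_and_not_add_card (R i') (R i)
    simp only [relDegree] at hd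
    omega

/-- After reordering the rows without disturbing their degrees much, column degrees still predict
the adjacency of a row away from its window. -/
lemma card_nonadj_reorder_le (hR : AlmostNested R t) (σ : Fin m ≃ Fin m)
    (hσ : ∀ i i', σ i < σ i' → relDegree R i' ≤ relDegree R i + 2 * (t * t)) (i : Fin m) :
    #{j | ¬ R i j ∧ σ i + (t * t + 2 * t) < relDegree (Function.swap R) j} ≤
      3 * t + 8 * (t * t) := by
  set s := t * t with hs
  set c := relDegree (Function.swap R) with hc
  set A : Finset (Fin n) :=
    {j | ¬ R i j ∧ σ i + (s + 2 * t) < c j ∧ c j ≤ i + s ∧ j + s < relDegree R i} with hAdef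
  have hsub : ({j | ¬ R i j ∧ σ i + (s + 2 * t) < c j} : Finset (Fin n)) ⊆
      ({j | ¬ R i j ∧ i + s < c j} : Finset (Fin n)) ∪
      (({j | relDegree R i - s ≤ (j : ℕ) ∧ (j : ℕ) < relDegree R i + 3 * s} : Finset (Fin n)) ∪
        A) := by
    intro j hj
    simp only [hAdef, mem_filter, mem_univ, true_and, mem_union] at hj ⊢
    by_cases h₁ : i + s < c j
    · exact .inl ⟨hj.1, h₁⟩
    by_cases h₂ : j + s < relDegree R i
    · exact .inr (.inr ⟨hj.1, hj.2, by omega, h₂⟩)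
    refine .inr (.inl ⟨by omega, ?_⟩)
    by_contra h₃
    have hcover : ({i' | R i' j} : Finset (Fin m)) ⊆
        ({i' | R i' j ∧ relDegree R i' + s ≤ j} : Finset (Fin m)) ∪
        ({i' | 0 ≤ (σ i' : ℕ) ∧ (σ i' : ℕ) < σ i} : Finset (Fin m)) := by
      intro i' hi'
      simp only [mem_filter, mem_univ, true_and, mem_union] at hi' ⊢
      by_cases h₄ : relDegree R i' + s ≤ j
      · exact .inl ⟨hi', h₄⟩
      · refine .inr ⟨by omega, ?_⟩
        by_contra h₅
        rcases (not_lt.1 h₅).lt_or_eq with h₆ | h₆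
        · have := hσ i i' h₆
          omega
        · have : i = i' := σ.injective (Fin.ext h₆)
          subst this
          exact hj.1 hi'
    have h₄ := (card_le_card hcover).trans (card_union_le _ _)
    have h₅ : #{i' | R i' j ∧ relDegree R i' + s ≤ j} ≤ t := hR.swap.card_adj_le j
    have h₆ := card_filter_label_le (fun i' => (σ i' : ℕ))
      (fun a b hab => σ.injective (Fin.ext hab)) 0 (σ i)
    have h₇ : c j = #{i' | R i' j} := rfl
    omega
  have hA : #A ≤ 2 * (t + 2 * s) := by
    set K : Finset (Fin m) := {k | k < i ∧ σ i < σ k} with hK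
    have hcase := card_le_or_card_le A K (fun j k => R k j) t (t + 2 * s) ?_ ?_
    · rcases hcase with h | h
      · exact h
      · rcases A.eq_empty_or_nonempty with hE | ⟨j, hj⟩
        · simp [hE]
        · exfalso
          simp only [hAdef, mem_filter, mem_univ, true_and] at hj
          have hcover : ({k | (k : ℕ) < i} : Finset (Fin m)) ⊆
              K ∪ ({k | 0 ≤ (σ k : ℕ) ∧ (σ k : ℕ) < σ i} : Finset (Fin m)) := by
            intro k hk
            simp only [hK, mem_filter, mem_univ, true_and, mem_union] at hk ⊢
            rcases lt_trichotomy (σ k) (σ i) with h' | h' | h'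
            · exact .inr ⟨by omega, h'⟩
            · have := σ.injective h'
              subst this
              omega
            · exact .inl ⟨hk, h'⟩
          have h₄ := (card_le_card hcover).trans (card_union_le _ _)
          have h₆ := card_filter_label_le (fun i' => (σ i' : ℕ))
            (fun a b hab => σ.injective (Fin.ext hab)) 0 (σ i)
          rw [card_fin_lt _ i.2.le] at h₄
          omega
    · intro j hj
      simp only [hAdef, mem_filter, mem_univ, true_and] at hj
      refine (card_le_card ?_).trans (hR.swap.card_nonadj_le j)
      intro k hk
      simp only [hK, mem_filter, mem_univ, true_and] at hk ⊢
      have := hR.row_degree k i hk.1.1.le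
      exact ⟨hk.2, show j + t * t < relDegree R k by omega⟩
    · intro k hk
      simp only [hK, mem_filter, mem_univ, true_and] at hk
      refine (card_le_card ?_).trans (hR.card_diff_le i k (2 * s) (hσ i k hk.2))
      intro j hj
      simp only [hAdef, mem_filter, mem_univ, true_and] at hj ⊢
      exact ⟨hj.2, hj.1.1⟩
  have h₁ := (card_le_card hsub).trans ((card_union_le _ _).trans
    (Nat.add_le_add_left (card_union_le _ _) _))
  have h₂ : #{j | ¬ R i j ∧ i + s < c j} ≤ t := hR.card_nonadj_le i
  have h₃ := card_filter_label_le (fun j : Fin n => (j : ℕ)) Fin.val_injective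
    (relDegree R i - s) (relDegree R i + 3 * s)
  omega

lemma card_adj_reorder_le (hR : AlmostNested R t) (σ : Fin m ≃ Fin m)
    (hσ : ∀ i i', σ i < σ i' → relDegree R i' ≤ relDegree R i + 2 * (t * t)) (i : Fin m) :
    #{j | R i j ∧ relDegree (Function.swap R) j + (t * t + 2 * t) ≤ σ i} ≤
      3 * t + 8 * (t * t) := by
  have h := hR.compRev.card_nonadj_reorder_le ((Fin.revPerm.trans σ).trans Fin.revPerm) ?_
    (Fin.rev i)
  · rw [← card_filter_rev] at h
    refine (card_le_card ?_).trans h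
    intro j hj
    simp only [mem_filter, mem_univ, true_and] at hj ⊢
    have h₁ := relDegree_swap_compRev R (Fin.rev j)
    have h₂ := Fin.val_rev (σ i)
    have h₃ := (σ i).2
    rw [Fin.rev_rev] at h₁
    refine ⟨by simpa [_root_.compRev] using hj.1, ?_⟩
    simp only [Equiv.trans_apply, Fin.revPerm_apply, Fin.rev_rev]
    omega
  · intro a b hab
    simp only [Equiv.trans_apply, Fin.revPerm_apply, Fin.rev_lt_rev] at hab
    have h₁ := hσ _ _ hab
    have h₂ := relDegree_compRev R a
    have h₃ := relDegree_compRev R b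
    omega

/-- A reordering of the rows after which every column is almost an initial segment. -/
lemma exists_reorder (hR : AlmostNested R t) :
    ∃ σ : Fin m ≃ Fin m,
      (∀ i i', σ i < σ i' → relDegree R i' ≤ relDegree R i + 2 * (t * t)) ∧
      ∀ j, #{i | R i j ∧ relDegree (Function.swap R) j ≤ σ i} ≤ 2 * t + 2 * (t * t) * t := by
  set s := t * t with hs
  have hfirst := fun i => exists_first_failure (fun j => ∀ hj : j < n, R i ⟨j, hj⟩)
    (relDegree R i - s) (relDegree R i + s) (by omega)
  choose h hlo hhi hbefore hafter using hfirst
  obtain ⟨e, he⟩ := exists_equiv_fin_antitone h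
  let e' : Fin m ≃ Fin m := (finCongr (Fintype.card_fin m)).symm.trans e
  have hσ : ∀ i i', e'.symm i < e'.symm i' → h i' ≤ h i := by
    intro i i' hlt
    have := he ((finCongr (Fintype.card_fin m)).symm (e'.symm i))
      ((finCongr (Fintype.card_fin m)).symm (e'.symm i')) (by simpa using hlt.le)
    have hid : ∀ k, e ((finCongr (Fintype.card_fin m)).symm (e'.symm k)) = k :=
      fun k => e'.apply_symm_apply k
    rwa [hid, hid] at this
  refine ⟨e'.symm, fun i i' hlt => ?_, fun j => ?_⟩
  · have h₁ := hσ i i' hlt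
    have h₂ := hlo i'
    have h₃ := hhi i
    omega
  generalize e'.symm = σ at hσ
  have hinj : Function.Injective fun i => (σ i : ℕ) := fun a b hab => σ.injective (Fin.ext hab)
  set c := relDegree (Function.swap R) j with hc
  set L : Finset (Fin m) := {i | (j : ℕ) < h i} with hL
  have hLR : #L ≤ c + t := by
    have hsub : L ⊆ ({i | R i j} : Finset (Fin m)) ∪
        ({i | ¬ R i j ∧ j + s < relDegree R i} : Finset (Fin m)) := by
      intro i hi
      simp only [hL, mem_filter, mem_univ, true_and, mem_union] at hi ⊢
      by_cases hij : R i j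
      · exact .inl hij
      · refine .inr ⟨hij, ?_⟩
        by_contra hlt
        exact hij (hbefore i j (by omega) hi j.2)
    have h₁ := (card_le_card hsub).trans (card_union_le _ _)
    have h₂ : #{i | ¬ R i j ∧ j + s < relDegree R i} ≤ t := hR.swap.card_nonadj_le j
    have h₃ : c = #{i | R i j} := rfl
    omega
  have hLlt : ∀ i ∈ L, (σ i : ℕ) < #L := by
    intro i hi
    simp only [hL, mem_filter, mem_univ, true_and] at hi
    have hmaps : ({p | (p : ℕ) < σ i + 1} : Finset (Fin m)).image σ.symm ⊆ L := by
      intro k hk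
      simp only [mem_image, mem_filter, mem_univ, true_and] at hk
      obtain ⟨p, hp, rfl⟩ := hk
      simp only [hL, mem_filter, mem_univ, true_and]
      rcases (Nat.lt_succ_iff.1 hp).lt_or_eq with h₁ | h₁
      · have := hσ (σ.symm p) i (by simpa using h₁)
        omega
      · have : p = σ i := Fin.ext h₁
        simpa [this] using hi
    have h₁ := card_le_card hmaps
    rw [card_image_of_injective _ σ.symm.injective, card_fin_lt _ (σ i).2] at h₁
    omega
  set J : Finset (Fin n) := {j' | (j : ℕ) - 2 * s ≤ (j' : ℕ) ∧ (j' : ℕ) < j} with hJ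
  have hsub : ({i | R i j ∧ c ≤ σ i} : Finset (Fin m)) ⊆
      (({i | R i j ∧ relDegree R i + s ≤ j} : Finset (Fin m)) ∪
        J.biUnion fun j' => {i | R i j ∧ ¬ R i j'}) ∪
      ({i | c ≤ (σ i : ℕ) ∧ (σ i : ℕ) < #L} : Finset (Fin m)) := by
    intro i hi
    simp only [hJ, mem_filter, mem_univ, true_and, mem_union, mem_biUnion] at hi ⊢
    by_cases hiL : (j : ℕ) < h i
    · exact .inr ⟨hi.2, hLlt i (by simpa [hL] using hiL)⟩
    by_cases hfar : relDegree R i + s ≤ j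
    · exact .inl (.inl ⟨hi.1, hfar⟩)
    obtain ⟨j', h₁, h₂, h₃⟩ := hafter i j (by omega) (by omega)
    push Not at h₃
    obtain ⟨hj', h₃⟩ := h₃
    have hne : j' ≠ j := by
      rintro rfl
      exact h₃ hi.1
    exact .inl (.inr ⟨⟨j', hj'⟩, ⟨by simp only; omega, by simp only; omega⟩, hi.1, h₃⟩)
  have h₁ := (card_le_card hsub).trans ((card_union_le _ _).trans
    (Nat.add_le_add_right (card_union_le _ _) _))
  have h₂ : #{i | R i j ∧ relDegree R i + s ≤ j} ≤ t := hR.swap.card_adj_le j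
  have h₃ : #(J.biUnion fun j' => ({i | R i j ∧ ¬ R i j'} : Finset (Fin m))) ≤ #J * t := by
    refine card_biUnion_le_card_mul _ _ t fun j' hj' => hR.col j' j ?_
    simp only [hJ, mem_filter, mem_univ, true_and] at hj'
    exact hj'.2
  have h₄ : #J ≤ 2 * s :=
     (card_filter_label_le (fun j : Fin n => (j : ℕ)) Fin.val_injective _ _).trans (by omega)
  have h₅ : #J * t ≤ 2 * s * t := Nat.mul_le_mul_right _ h₄
  have h₆ := card_filter_label_le _ hinj c #L
  omega

lemma exists_labelling (hR : AlmostNested R t) :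
    ∃ (k : Fin m → ℕ) (g : Fin n → ℕ),
      (∀ i, #{j | ¬ R i j ∧ k i < g j} + #{j | R i j ∧ g j ≤ k i} ≤ 40 * t ^ 4) ∧
      ∀ j, #{i | ¬ R i j ∧ k i < g j} + #{i | R i j ∧ g j ≤ k i} ≤ 40 * t ^ 4 := by
  obtain ⟨σ, hσ, hcol⟩ := hR.exists_reorder
  have hinj : Function.Injective fun i => (σ i : ℕ) := fun a b hab => σ.injective (Fin.ext hab)
  have hrow₁ := hR.card_nonadj_reorder_le σ hσ
  have hrow₂ := hR.card_adj_reorder_le σ hσ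
  have hp₁ : t ≤ t ^ 4 := Nat.le_self_pow (by norm_num) t
  have hp₂ : t * t ≤ t ^ 4 := by nlinarith [Nat.le_self_pow (n := 2) (by norm_num) (t * t)]
  have hp₃ : t * t * t ≤ t ^ 4 := by nlinarith [Nat.le_self_pow (n := 2) (by norm_num) t]
  set S := t * t + 2 * t with hS
  set c := relDegree (Function.swap R) with hc
  have hfirst := fun j => exists_first_failure (fun p => ∀ hp : p < m, R (σ.symm ⟨p, hp⟩) j)
    (c j - S) (c j + S) (by omega)
  choose g hlo hhi hbefore hafter using hfirst
  have hmiss : ∀ i j, ¬ R i j → (σ i : ℕ) < g j → σ i + S < c j := by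
    intro i j hij hlt
    by_contra hge
    have := hbefore j (σ i) (by omega) hlt (σ i).2
    exact hij (by simpa using this)
  refine ⟨fun i => σ i, g, fun i => ?_, fun j => ?_⟩
  · have h₁ : #{j | ¬ R i j ∧ (σ i : ℕ) < g j} ≤ 3 * t + 8 * (t * t) := by
      refine (card_le_card ?_).trans (hrow₁ i)
      intro j hj
      simp only [mem_filter, mem_univ, true_and] at hj ⊢
      exact ⟨hj.1, hmiss i j hj.1 hj.2⟩
    set I : Finset (Fin m) := {i' | σ i - 2 * S ≤ (σ i' : ℕ) ∧ (σ i' : ℕ) < σ i} with hI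
    have hsub : ({j | R i j ∧ g j ≤ σ i} : Finset (Fin n)) ⊆
        ({j | R i j ∧ c j + S ≤ σ i} : Finset (Fin n)) ∪
        I.biUnion fun i' => {j | R i j ∧ ¬ R i' j} := by
      intro j hj
      simp only [hI, mem_filter, mem_univ, true_and, mem_union, mem_biUnion] at hj ⊢
      by_cases hfar : c j + S ≤ σ i
      · exact .inl ⟨hj.1, hfar⟩
      obtain ⟨p, h₂, h₃, h₄⟩ := hafter j (σ i) hj.2 (by omega)
      push Not at h₄
      obtain ⟨hp, h₄⟩ := h₄
      have hne : p ≠ σ i := by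
        rintro rfl
        exact h₄ (by simpa using hj.1)
      refine .inr ⟨σ.symm ⟨p, hp⟩, ?_, hj.1, h₄⟩
      simp only [Equiv.apply_symm_apply]
      omega
    have h₂ := (card_le_card hsub).trans (card_union_le _ _)
    have h₃ : #(I.biUnion fun i' => ({j | R i j ∧ ¬ R i' j} : Finset (Fin n))) ≤
        #I * (t + 2 * (t * t)) := by
      refine card_biUnion_le_card_mul _ _ _ fun i' hi' => hR.card_diff_le i' i _ (hσ i' i ?_)
      simp only [hI, mem_filter, mem_univ, true_and] at hi'
      exact hi'.2
    have h₄ : #I ≤ 2 * S := (card_filter_label_le _ hinj _ _).trans (by omega)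
    have h₅ : #I * (t + 2 * (t * t)) ≤ 2 * S * (t + 2 * (t * t)) := Nat.mul_le_mul_right _ h₄
    have h₆ : 2 * S * (t + 2 * (t * t)) = 4 * (t * t) + 10 * (t * t * t) + 4 * t ^ 4 := by
      rw [hS]
      ring
    have h₇ := hrow₂ i
    beta_reduce
    omega
  · have h₁ := card_and_not_add_card (fun i => (σ i : ℕ) < c j) (fun i => R i j)
    have h₂ := card_filter_label_le _ hinj 0 (c j)
    simp only [zero_le, true_and, Nat.sub_zero] at h₂
    have h₃ : c j = #{i | R i j} := rfl
    have h₄ := hcol j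
    have h₅ : #{i | R i j ∧ ¬ (σ i : ℕ) < c j} ≤ 2 * t + 2 * (t * t) * t := by
      simpa only [not_lt] using h₄
    have h₆ : #{i | ¬ R i j ∧ (σ i : ℕ) < g j} ≤ #{i | (σ i : ℕ) < c j ∧ ¬ R i j} := by
      refine card_le_card ?_
      intro i hi
      simp only [mem_filter, mem_univ, true_and] at hi ⊢
      have := hmiss i j hi.1 hi.2
      exact ⟨by omega, hi.1⟩
    have hsub : ({i | R i j ∧ g j ≤ σ i} : Finset (Fin m)) ⊆
        ({i | R i j ∧ c j ≤ σ i} : Finset (Fin m)) ∪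
        ({i | c j - S ≤ (σ i : ℕ) ∧ (σ i : ℕ) < c j} : Finset (Fin m)) := by
      intro i hi
      simp only [mem_filter, mem_univ, true_and, mem_union] at hi ⊢
      have := hlo j
      by_cases h : c j ≤ σ i
      · exact .inl ⟨hi.1, h⟩
      · exact .inr (by omega)
    have h₇ := (card_le_card hsub).trans (card_union_le _ _)
    have h₈ := card_filter_label_le _ hinj (c j - S) (c j)
    have h₉ : 2 * (t * t) * t = 2 * (t * t * t) := by ring
    beta_reduce
    omega

end AlmostNested

/-- A relation whose rows and columns are pairwise comparable up to `t` elements is locally close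
to a threshold relation. -/
lemma exists_threshold_relation {α β : Type*} [Fintype α] [Fintype β] (R : α → β → Prop) (t : ℕ)
    (hrow : ∀ x x', x ≠ x' → #{y | R x' y ∧ ¬ R x y} ≤ t ∨ #{y | R x y ∧ ¬ R x' y} ≤ t)
    (hcol : ∀ y y', y ≠ y' → #{x | R x y' ∧ ¬ R x y} ≤ t ∨ #{x | R x y ∧ ¬ R x y'} ≤ t) :
    ∃ (k : α → ℕ) (g : β → ℕ),
      (∀ x, #{y | ¬ R x y ∧ k x < g y} + #{y | R x y ∧ g y ≤ k x} ≤ 40 * t ^ 4) ∧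
      ∀ y, #{x | ¬ R x y ∧ k x < g y} + #{x | R x y ∧ g y ≤ k x} ≤ 40 * t ^ 4 := by
  obtain ⟨e, he⟩ := exists_equiv_fin_antitone (relDegree R)
  obtain ⟨f, hf⟩ := exists_equiv_fin_antitone (relDegree (Function.swap R))
  let Rfin : Fin (Fintype.card α) → Fin (Fintype.card β) → Prop := fun i j => R (e i) (f j)
  have hr : ∀ i, relDegree Rfin i = relDegree R (e i) := fun i =>
    card_filter_equiv f fun y => R (e i) y
  have hc : ∀ j, relDegree (Function.swap Rfin) j = relDegree (Function.swap R) (f j) := fun j =>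
    card_filter_equiv e fun x => R x (f j)
  have hR' : AlmostNested Rfin t := by
    refine ⟨fun i i' hi => ?_, fun j j' hj => ?_, fun i i' hi => ?_, fun j j' hj => ?_⟩
    · have h₁ := card_filter_equiv f fun y => R (e i') y ∧ ¬ R (e i) y
      have h₂ := card_and_not_add_card (fun y => R (e i') y) (fun y => R (e i) y)
      have h₃ : #{y | R (e i') y} ≤ #{y | R (e i) y} := he i i' hi.le
      have h₄ := hrow (e i) (e i') (e.injective.ne hi.ne)
      simp only [Rfin]
      omega
    · have h₁ := card_filter_equiv e fun x => R x (f j') ∧ ¬ R x (f j)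
      have h₂ := card_and_not_add_card (fun x => R x (f j')) (fun x => R x (f j))
      have h₃ : #{x | R x (f j')} ≤ #{x | R x (f j)} := hf j j' hj.le
      have h₄ := hcol (f j) (f j') (f.injective.ne hj.ne)
      simp only [Rfin]
      omega
    · rw [hr, hr]
      exact he i i' hi
    · rw [hc, hc]
      exact hf j j' hj
  obtain ⟨k, g, hk, hg⟩ := hR'.exists_labelling
  refine ⟨fun x => k (e.symm x), fun y => g (f.symm y), fun x => ?_, fun y => ?_⟩
  · refine le_trans (le_of_eq ?_) (hk (e.symm x))
    rw [← card_filter_equiv f, ← card_filter_equiv f]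
    simp [Rfin]
  · refine le_trans (le_of_eq ?_) (hg (f.symm y))
    rw [← card_filter_equiv e, ← card_filter_equiv e]
    simp [Rfin]

/-! ### Splitting off a clique and a stable set -/

/-- The first `c` vertices form almost a clique if all of them have degree at least `c - 1`. -/
lemma card_nonadj_initial_le {n : ℕ} (G : SimpleGraph (Fin n)) (t c : ℕ)
    (hdom : ∀ i i', i < i' → #{w | w ≠ i ∧ w ≠ i' ∧ G.Adj w i' ∧ ¬ G.Adj w i} ≤ t)
    (hdeg : ∀ a : Fin n, (a : ℕ) < c → c ≤ relDegree G.Adj a + 1) (i : Fin n) (hi : (i : ℕ) < c) :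
    #{a : Fin n | (a : ℕ) < c ∧ a ≠ i ∧ ¬ G.Adj i a} ≤ 3 * (t * t) + 2 * t := by
  set A : Finset (Fin n) := {a | (a : ℕ) < c ∧ a ≠ i ∧ ¬ G.Adj i a} with hA
  set B : Finset (Fin n) := {b | c ≤ (b : ℕ) ∧ G.Adj i b} with hB
  set A₁ : Finset (Fin n) := {a | a < i ∧ ¬ G.Adj i a} with hA₁
  set A₂ : Finset (Fin n) := {a | i < a ∧ (a : ℕ) < c ∧ ¬ G.Adj i a} with hA₂
  have hdeg_eq : ∀ a, relDegree G.Adj a = #{w | G.Adj a w} := fun _ => rfl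
  simp only [hdeg_eq] at hdeg
  have hAB : #A ≤ #B := by
    by_cases hc : c ≤ n
    · have hsplit : ({a | (a : ℕ) < c} : Finset (Fin n)) =
          insert i (A ∪ ({a | (a : ℕ) < c ∧ G.Adj i a} : Finset (Fin n))) := by
        ext a
        simp only [hA, mem_filter, mem_univ, true_and, mem_insert, mem_union]
        constructor
        · intro h
          tauto
        · rintro (rfl | h | h)
          · exact hi
          · exact h.1
          · exact h.1
      have h₁ : c = #A + #{a : Fin n | (a : ℕ) < c ∧ G.Adj i a} + 1 := by
        rw [← card_union_of_disjoint, ← card_insert_of_notMem, ← hsplit, card_fin_lt _ hc]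
        · simp [hA]
        · rw [disjoint_left]
          intro a ha ha'
          simp only [hA, mem_filter, mem_univ, true_and] at ha ha'
          exact ha.2.2 ha'.2
      have hnbr : ({w | G.Adj i w} : Finset (Fin n)) ⊆
          ({a | (a : ℕ) < c ∧ G.Adj i a} : Finset (Fin n)) ∪ B := by
        intro w hw
        simp only [hB, mem_filter, mem_univ, true_and, mem_union] at hw ⊢
        by_cases h : (w : ℕ) < c
        · exact .inl ⟨h, hw⟩
        · exact .inr ⟨by omega, hw⟩
      have h₂ := (card_le_card hnbr).trans (card_union_le _ _)
      have h₃ := hdeg i hi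
      omega
    · exfalso
      have h₁ : #{w | G.Adj i w} < n := by
        have h : #({w | G.Adj i w} : Finset (Fin n)) < #(univ : Finset (Fin n)) :=
          card_lt_card (ssubset_univ_iff.2 fun h => by
            have : i ∈ ({w | G.Adj i w} : Finset (Fin n)) := by rw [h]; exact mem_univ i
            simp at this)
        simpa using h
      have h₂ := hdeg i hi
      omega
  -- vertices after `i` have at most `t` neighbours in `A`
  have hlate : ∀ w, i < w → #{a ∈ A | G.Adj a w} ≤ t := by
    intro w hw
    refine (card_le_card ?_).trans (hdom i w hw)
    intro a ha
    simp only [hA, mem_filter, mem_univ, true_and] at ha ⊢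
    exact ⟨ha.1.2.1, ha.2.ne, ha.2, fun h => ha.1.2.2 h.symm⟩
  have hbound₁ : #A₁ ≤ 2 * (t * t) + t := by
    have hlargeA : #{a ∈ A₁ | t * t < #{w ∈ B | G.Adj a w}} ≤ t := by
      refine card_large_le (fun a : Fin n => ((a : ℕ) : ℤ)) A₁ B (fun a w => G.Adj a w) t t ?_ ?_
      · intro a ha b hb hab hle
        refine (card_le_card ?_).trans (hdom a b (lt_of_le_of_ne (by simpa using hle) hab))
        intro w hw
        simp only [hA₁, hB, mem_filter, mem_univ, true_and] at hw ha hb ⊢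
        refine ⟨?_, hw.2.1.ne', hw.2.1.symm, fun h => hw.2.2 h.symm⟩
        rintro rfl
        have := ha.1
        omega
      · intro w hw
        simp only [hB, mem_filter, mem_univ, true_and] at hw
        refine (card_le_card ?_).trans (hlate w (by omega))
        intro a ha
        simp only [hA, hA₁, mem_filter, mem_univ, true_and] at ha ⊢
        exact ⟨⟨by omega, ha.1.1.ne, ha.1.2⟩, ha.2⟩
    have hlargeB : #{b ∈ B | t * t < #{w ∈ A₁ | ¬ G.Adj b w}} ≤ t := by
      refine card_large_le (fun b : Fin n => -((b : ℕ) : ℤ)) B A₁ (fun b w => ¬ G.Adj b w) t t ?_ ?_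
      · intro a ha b hb hab hle
        refine (card_le_card ?_).trans
          (hdom b a (lt_of_le_of_ne (by simpa using hle) hab.symm))
        intro w hw
        simp only [hA₁, hB, mem_filter, mem_univ, true_and, not_not] at hw ha hb ⊢
        refine ⟨?_, hw.2.2.ne', hw.2.2.symm, fun h => hw.2.1 h.symm⟩
        rintro rfl
        exact hw.1.2 hb.2
      · intro w hw
        simp only [hA₁, mem_filter, mem_univ, true_and] at hw
        refine (card_le_card ?_).trans (hdom w i hw.1)
        intro b hb
        simp only [hB, mem_filter, mem_univ, true_and] at hb ⊢
        refine ⟨?_, hb.1.2.ne', hb.1.2.symm, hb.2⟩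
        rintro rfl
        exact hw.2 hb.1.2
    set A' : Finset (Fin n) := {a ∈ A₁ | ¬ t * t < #{w ∈ B | G.Adj a w}} with hA'
    set B' : Finset (Fin n) := {b ∈ B | ¬ t * t < #{w ∈ A₁ | ¬ G.Adj b w}} with hB'
    have hcA : #{a ∈ A₁ | t * t < #{w ∈ B | G.Adj a w}} + #A' = #A₁ :=
      card_filter_add_card_filter_not _
    have hcB : #{b ∈ B | t * t < #{w ∈ A₁ | ¬ G.Adj b w}} + #B' = #B :=
      card_filter_add_card_filter_not _
    have hA₁A : #A₁ ≤ #A := by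
      refine card_le_card ?_
      intro a ha
      simp only [hA, hA₁, mem_filter, mem_univ, true_and] at ha ⊢
      exact ⟨by omega, ha.1.ne, ha.2⟩
    have hcase := card_le_or_card_le A' B' (fun a b => ¬ G.Adj b a) (t * t) (t * t) ?_ ?_
    · omega
    · intro a ha
      have ha' := mem_filter.1 ha
      refine (card_le_card ?_).trans (not_lt.1 ha'.2)
      intro b hb
      simp only [hB', mem_filter, not_not] at hb ⊢
      exact ⟨hb.1.1, hb.2.symm⟩
    · intro b hb
      have hb' := mem_filter.1 hb
      refine (card_le_card ?_).trans (not_lt.1 hb'.2)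
      intro a ha
      simp only [hA', mem_filter] at ha ⊢
      exact ⟨ha.1.1, ha.2⟩
  have hbound₂ : #A₂ ≤ t * t + t := by
    have hlarge : #{a ∈ A₂ | t * (t + 1) < #{w ∈ ({w | i < w} : Finset (Fin n)) | G.Adj a w}} ≤
        t := by
      refine card_large_le (fun a : Fin n => ((a : ℕ) : ℤ)) A₂ {w | i < w}
        (fun a w => G.Adj a w) t (t + 1) ?_ ?_
      · intro a ha b hb hab hle
        refine le_trans (card_le_card ?_) ((card_insert_le a _).trans (Nat.add_le_add_right
          (hdom a b (lt_of_le_of_ne (by simpa using hle) hab)) 1))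
        intro w hw
        simp only [mem_filter, mem_univ, true_and, mem_insert] at hw ⊢
        by_cases h : w = a
        · exact .inl h
        · exact .inr ⟨h, hw.2.1.ne', hw.2.1.symm, fun h => hw.2.2 h.symm⟩
      · intro w hw
        simp only [mem_filter, mem_univ, true_and] at hw
        refine (card_le_card ?_).trans (hlate w hw)
        intro a ha
        simp only [hA, hA₂, mem_filter, mem_univ, true_and] at ha ⊢
        exact ⟨⟨ha.1.2.1, ha.1.1.ne', ha.1.2.2⟩, ha.2⟩
    by_cases hc : c ≤ i + 1 + t * (t + 1)
    · have h₁ := card_filter_label_le (fun a : Fin n => (a : ℕ)) Fin.val_injective (i + 1) c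
      have h₂ : #A₂ ≤ #{a : Fin n | i + 1 ≤ (a : ℕ) ∧ (a : ℕ) < c} := by
        refine card_le_card ?_
        intro a ha
        simp only [hA₂, mem_filter, mem_univ, true_and] at ha ⊢
        exact ⟨ha.1, ha.2.1⟩
      have h₃ : t * (t + 1) = t * t + t := by ring
      omega
    · have hall : A₂ ⊆
          {a ∈ A₂ | t * (t + 1) < #{w ∈ ({w | i < w} : Finset (Fin n)) | G.Adj a w}} := by
        intro a ha
        refine mem_filter.2 ⟨ha, ?_⟩
        simp only [hA₂, mem_filter, mem_univ, true_and] at ha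
        have hsub : ({w | G.Adj a w} : Finset (Fin n)) ⊆ ({w | (w : ℕ) < i} : Finset (Fin n)) ∪
            {w ∈ ({w | i < w} : Finset (Fin n)) | G.Adj a w} := by
          intro w hw
          simp only [mem_filter, mem_univ, true_and, mem_union] at hw ⊢
          rcases lt_trichotomy w i with h | h | h
          · exact .inl h
          · subst h
            exact absurd hw.symm ha.2.2
          · exact .inr ⟨h, hw⟩
        have h₁ := (card_le_card hsub).trans (card_union_le _ _)
        rw [card_fin_lt _ i.2.le] at h₁
        have h₂ := hdeg a ha.2.1
        omega
      have h₁ := (card_le_card hall).trans hlarge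
      omega
  have hsub : A ⊆ A₁ ∪ A₂ := by
    intro a ha
    simp only [hA, hA₁, hA₂, mem_filter, mem_univ, true_and, mem_union] at ha ⊢
    rcases lt_or_gt_of_ne ha.2.1 with h | h
    · exact .inl ⟨h, ha.2.2⟩
    · exact .inr ⟨h, ha.1, ha.2.2⟩
  have := (card_le_card hsub).trans (card_union_le _ _)
  omega

/-- A graph listed with decreasing degrees in which every vertex is dominated by the earlier ones
splits into an almost-clique followed by an almost-stable set. -/
lemma exists_split_fin {n : ℕ} (G : SimpleGraph (Fin n)) (t : ℕ)
    (hdom : ∀ i i', i < i' → #{w | w ≠ i ∧ w ≠ i' ∧ G.Adj w i' ∧ ¬ G.Adj w i} ≤ t)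
    (hanti : ∀ i i', i ≤ i' → relDegree G.Adj i' ≤ relDegree G.Adj i) :
    ∃ c : ℕ,
      (∀ i : Fin n, (i : ℕ) < c →
        #{a : Fin n | (a : ℕ) < c ∧ a ≠ i ∧ ¬ G.Adj i a} ≤ 3 * (t * t) + 2 * t) ∧
      ∀ i : Fin n, c ≤ (i : ℕ) →
        #{a : Fin n | c ≤ (a : ℕ) ∧ G.Adj i a} ≤ 3 * (t * t) + 2 * t := by
  have hex : ∃ c : ℕ, ∀ v : Fin n, c ≤ (v : ℕ) → relDegree G.Adj v < v :=
    ⟨n, fun v hv => absurd v.2 (by omega)⟩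
  have hspec := Nat.find_spec hex
  have hmin := fun b => Nat.find_min hex (m := b)
  have hcn : Nat.find hex ≤ n := Nat.find_min' hex fun v hv => absurd v.2 (by omega)
  set c := Nat.find hex with hc
  refine ⟨c, fun i hi => ?_, fun i hi => ?_⟩
  · refine card_nonadj_initial_le G t c hdom (fun a ha => ?_) i hi
    have h₁ := hmin (c - 1) (by omega)
    push Not at h₁
    obtain ⟨v, hv, hdv⟩ := h₁
    have hvc : ¬ c ≤ (v : ℕ) := fun h => by
      have := hspec v h
      omega
    have h₂ := hanti a v (Fin.le_def.2 (by omega))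
    omega
  · obtain ⟨G', hG'⟩ : ∃ G' : SimpleGraph (Fin n),
        ∀ a b, G'.Adj a b ↔ a ≠ b ∧ ¬ G.Adj (Fin.rev a) (Fin.rev b) :=
      ⟨Gᶜ.comap Fin.rev, by simp⟩
    have h := card_nonadj_initial_le G' t (n - c) ?_ ?_ (Fin.rev i) (by rw [Fin.val_rev]; omega)
    · rw [← card_filter_rev] at h
      refine (card_le_card ?_).trans h
      intro a ha
      simp only [mem_filter, mem_univ, true_and] at ha ⊢
      refine ⟨by rw [Fin.val_rev]; omega, Fin.rev_injective.ne ha.2.ne', ?_⟩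
      simp [hG', ha.2]
    · intro a b hab
      have h := hdom (Fin.rev b) (Fin.rev a) (Fin.rev_lt_rev.2 hab)
      rw [← card_filter_rev] at h
      refine (card_le_card ?_).trans h
      intro w hw
      simp only [mem_filter, mem_univ, true_and, hG', ne_eq, Fin.rev_inj] at hw ⊢
      tauto
    · intro a ha
      have hra : c ≤ (Fin.rev a : ℕ) := by
        rw [Fin.val_rev]
        omega
      have hcn' : c < n := by omega
      have h₁ : relDegree G.Adj ⟨c, hcn'⟩ < c := hspec ⟨c, hcn'⟩ le_rfl
      have h₂ := hanti ⟨c, hcn'⟩ (Fin.rev a) hra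
      have hcover : (univ : Finset (Fin n)) ⊆ insert a
          (({w | G'.Adj a w} : Finset (Fin n)) ∪
            ({w | G.Adj (Fin.rev a) (Fin.rev w)} : Finset (Fin n))) := by
        intro w _
        simp only [mem_filter, mem_univ, true_and, mem_insert, mem_union, hG', ne_eq]
        tauto
      have h₃ := (card_le_card hcover).trans ((card_insert_le _ _).trans
        (Nat.add_le_add_right (card_union_le _ _) 1))
      have h₄ : #{w | G.Adj (Fin.rev a) (Fin.rev w)} = relDegree G.Adj (Fin.rev a) :=
        card_filter_rev fun w => G.Adj (Fin.rev a) w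
      have h₅ : relDegree G'.Adj a = #{w | G'.Adj a w} := rfl
      rw [card_univ, Fintype.card_fin] at h₃
      omega

lemma dominates_iff_card_le {V : Type*} [Fintype V] (G : SimpleGraph V) (t : ℕ) (u v : V) :
    Dominates G t u v ↔ #{w | w ≠ u ∧ w ≠ v ∧ G.Adj w v ∧ ¬ G.Adj w u} ≤ t := by
  rw [Dominates, Set.ncard_eq_toFinset_card']
  simp

/-- In a `t`-dominating graph, vertices of larger degree dominate. -/
lemma IsTDominating.dominates_of_degree_le {V : Type*} [Fintype V] {G : SimpleGraph V} {t : ℕ}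
    (hG : IsTDominating G t) {u v : V} (huv : u ≠ v)
    (hdeg : relDegree G.Adj v ≤ relDegree G.Adj u) : Dominates G t u v := by
  rcases hG u v huv with h | h
  · exact h
  rw [dominates_iff_card_le] at h ⊢
  have h₁ := card_and_not_add_card (fun w => w ≠ u ∧ G.Adj w v) (fun w => w ≠ v ∧ G.Adj w u)
  have key : ∀ u v : V, #{w | w ≠ u ∧ G.Adj w v} + (if G.Adj u v then 1 else 0) =
      relDegree G.Adj v := by
    intro u v
    have hu : #{w | w = u ∧ G.Adj w v} = if G.Adj u v then 1 else 0 := by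
      split_ifs with hadj
      · rw [card_eq_one]
        refine ⟨u, ?_⟩
        ext w
        simp only [mem_filter, mem_univ, true_and, mem_singleton]
        exact ⟨fun h => h.1, fun h => ⟨h, h ▸ hadj⟩⟩
      · rw [card_eq_zero, filter_eq_empty_iff]
        rintro w - ⟨rfl, hw⟩
        exact hadj hw
    rw [← hu, ← card_union_of_disjoint]
    · refine congrArg card ?_
      ext w
      simp only [mem_union, mem_filter, mem_univ, true_and, G.adj_comm v w]
      tauto
    · rw [disjoint_left]
      intro w hw hw'
      simp only [mem_filter, mem_univ, true_and] at hw hw'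
      exact hw.1 hw'.1
  have h₂ := key u v
  have h₃ := key v u
  simp only [G.adj_comm v u] at h₃
  have h₄ : #{w | w ≠ u ∧ w ≠ v ∧ G.Adj w v ∧ ¬ G.Adj w u} =
      #{w | (w ≠ u ∧ G.Adj w v) ∧ ¬ (w ≠ v ∧ G.Adj w u)} := by
    refine congrArg card ?_
    ext w
    simp only [mem_filter, mem_univ, true_and]
    refine ⟨by tauto, fun h => ?_⟩
    have := h.1.2.ne
    tauto
  have h₅ : #{w | w ≠ v ∧ w ≠ u ∧ G.Adj w u ∧ ¬ G.Adj w v} =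
      #{w | (w ≠ v ∧ G.Adj w u) ∧ ¬ (w ≠ u ∧ G.Adj w v)} := by
    refine congrArg card ?_
    ext w
    simp only [mem_filter, mem_univ, true_and]
    refine ⟨by tauto, fun h => ?_⟩
    have := h.1.2.ne
    tauto
  omega

lemma IsTDominating.exists_split {V : Type*} [Fintype V] {G : SimpleGraph V} {t : ℕ}
    (hG : IsTDominating G t) :
    ∃ X : Set V,
      (∀ v ∈ X, #{a | a ∈ X ∧ a ≠ v ∧ ¬ G.Adj v a} ≤ 3 * (t * t) + 2 * t) ∧
      ∀ v ∉ X, #{a | a ∉ X ∧ G.Adj v a} ≤ 3 * (t * t) + 2 * t := by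
  obtain ⟨e, he⟩ := exists_equiv_fin_antitone (relDegree G.Adj)
  have hdeg : ∀ i, relDegree (G.comap e).Adj i = relDegree G.Adj (e i) := fun i =>
    card_filter_equiv e fun y => G.Adj (e i) y
  obtain ⟨c, hX, hY⟩ := exists_split_fin (G.comap e) t
    (fun i i' hi => by
      have h := (dominates_iff_card_le G t _ _).1
        (hG.dominates_of_degree_le (e.injective.ne hi.ne) (he i i' hi.le))
      rw [← card_filter_equiv e] at h
      simpa using h)
    (fun i i' hi => by
      rw [hdeg, hdeg]
      exact he i i' hi)
  refine ⟨{v | (e.symm v : ℕ) < c}, fun v hv => ?_, fun v hv => ?_⟩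
  · refine le_trans (le_of_eq ?_) (hX (e.symm v) hv)
    rw [← card_filter_equiv e]
    simp [Equiv.eq_symm_apply]
  · refine le_trans (le_of_eq ?_) (hY (e.symm v) (not_lt.1 hv))
    rw [← card_filter_equiv e]
    simp

/-! ### The split half-graph -/

/-- The graph in which `X` is a clique, its complement is stable, and `x ∈ X` is adjacent to
`y ∉ X` iff `k x < g y`. -/
def splitThresholdGraph {V : Type*} (X : Set V) (k g : V → ℕ) : SimpleGraph V where
  Adj u v := u ≠ v ∧ ((u ∈ X ∧ v ∈ X) ∨ (u ∈ X ∧ v ∉ X ∧ k u < g v) ∨ (v ∈ X ∧ u ∉ X ∧ k v < g u))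
  symm := ⟨fun u v h => ⟨h.1.symm, by tauto⟩⟩
  loopless := ⟨fun u h => h.1 rfl⟩

lemma isSplitHalfGraph_splitThresholdGraph {V : Type*} [Fintype V] (X : Set V) (k g : V → ℕ) :
    IsSplitHalfGraph (splitThresholdGraph X k g) := by
  let N := Fintype.card V
  let e : V → ℕ := fun v => Fintype.equivFin V v
  have he : ∀ v, e v < N := fun v => (Fintype.equivFin V v).2
  have hinj : Function.Injective e := fun a b h => (Fintype.equivFin V).injective (Fin.ext h)
  let M := ∑ v, k v
  have hM : ∀ v, k v ≤ M := fun v => single_le_sum (fun _ _ => Nat.zero_le _) (mem_univ v)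
  -- break ties in `q` by the enumeration `e`
  have hdiv : ∀ (q : ℕ) (v : V), (N * q + e v) / N = q := fun q v => by
    rw [Nat.mul_add_div (by have := he v; omega), Nat.div_eq_of_lt (he v), add_zero]
  let f : V → ℕ := fun v => if v ∈ X then N * (M - k v) + e v else N * g v + e v
  have hfX : ∀ v ∈ X, f v = N * (M - k v) + e v := fun v hv => if_pos hv
  have hfY : ∀ v ∉ X, f v = N * g v + e v := fun v hv => if_neg hv
  have heq : ∀ {p q : ℕ} {u v : V}, N * p + e u = N * q + e v → u = v := by
    intro p q u v h
    apply hinj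
    have := congrArg (· % N) h
    simpa [Nat.mul_add_mod, Nat.mod_eq_of_lt (he u), Nat.mod_eq_of_lt (he v)] using this
  refine ⟨X, Xᶜ, fun v => Classical.em _, disjoint_compl_right,
    fun x hx x' hx' hne => ⟨hne, .inl ⟨hx, hx'⟩⟩, ?_, f, ?_, ?_, ?_⟩
  · rintro y hy y' hy' ⟨-, h⟩
    simp only [Set.mem_compl_iff] at hy hy'
    tauto
  · intro x hx x' hx' h
    rw [hfX x hx, hfX x' hx'] at h
    exact heq h
  · intro y hy y' hy' h
    rw [hfY y hy, hfY y' hy'] at h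
    exact heq h
  · intro x hx x' hx' y hy y' hy' hxx hyy hadj
    simp only [Set.mem_compl_iff] at hy hy'
    rw [hfX x hx, hfX x' hx'] at hxx
    rw [hfY y hy, hfY y' hy'] at hyy
    have h₁ := Nat.div_le_div_right (c := N) hxx
    have h₂ := Nat.div_le_div_right (c := N) hyy
    rw [hdiv, hdiv] at h₁ h₂
    have h₃ := hM x
    have h₄ := hM x'
    have h₅ : k x < g y := by
      have := hadj.2
      tauto
    exact ⟨fun h => hy' (h ▸ hx'), .inr (.inl ⟨hx', hy', by omega⟩)⟩

/-- Counting a predicate on a subtype. -/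
lemma card_filter_subtype {V : Type*} [Fintype V] (S : Set V) [Fintype S] (P : V → Prop) :
    #{a : S | P a} = #{a : V | a ∈ S ∧ P a} := by
  refine card_bij (fun a _ => (a : V)) ?_ ?_ ?_
  · intro a ha
    simpa using ha
  · intro a _ b _ h
    exact Subtype.ext h
  · intro a ha
    simp only [mem_filter, mem_univ, true_and] at ha
    exact ⟨⟨a, ha.1⟩, by simpa using ha.2, rfl⟩

lemma IsTDominating.card_diff_subtype_le {V : Type*} [Fintype V] {G : SimpleGraph V} {t : ℕ}
    (hG : IsTDominating G t) {S : Set V} [Fintype S] {u v : V} (hu : u ∉ S) (hv : v ∉ S)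
    (huv : u ≠ v) :
    #{w : S | G.Adj v w ∧ ¬ G.Adj u w} ≤ t ∨ #{w : S | G.Adj u w ∧ ¬ G.Adj v w} ≤ t := by
  have key : ∀ u v : V, u ∉ S → v ∉ S → Dominates G t u v →
      #{w : S | G.Adj v w ∧ ¬ G.Adj u w} ≤ t := by
    intro u v hu hv h
    rw [dominates_iff_card_le] at h
    refine le_trans ?_ h
    refine card_le_card_of_injOn (fun w => (w : V)) ?_ Subtype.val_injective.injOn
    intro w hw
    simp only [coe_filter, mem_univ, true_and, Set.mem_ofPred_eq] at hw ⊢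
    exact ⟨fun h => hu (h ▸ w.2), fun h => hv (h ▸ w.2), hw.1.symm, fun h => hw.2 h.symm⟩
  exact (hG u v huv).imp (key u v hu hv) (key v u hv hu)

lemma ncard_diff_add_ncard_diff_le {V : Type*} [Fintype V] (G H : SimpleGraph V) (v : V) (S : Set V)
    (a b : ℕ) (hin : #{w | w ∈ S ∧ ¬ (G.Adj v w ↔ H.Adj v w)} ≤ a)
    (hout : #{w | w ∉ S ∧ ¬ (G.Adj v w ↔ H.Adj v w)} ≤ b) :
    (G.neighborSet v \ H.neighborSet v).ncard + (H.neighborSet v \ G.neighborSet v).ncard ≤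
      a + b := by
  rw [← Set.ncard_union_eq (by
    rw [Set.disjoint_left]
    exact fun w hw hw' => hw.2 hw'.1), Set.ncard_eq_toFinset_card']
  refine le_trans (card_le_card ?_) ((card_union_le _ _).trans (Nat.add_le_add hin hout))
  intro w hw
  simp only [Set.mem_toFinset, Set.mem_union, Set.mem_sdiff, SimpleGraph.mem_neighborSet] at hw
  simp only [mem_union, mem_filter, mem_univ, true_and]
  tauto

lemma exists_splitThresholdGraph {V : Type*} [Fintype V] {G : SimpleGraph V} {t : ℕ}
    (hG : IsTDominating G t) :
    ∃ (X : Set V) (k g : V → ℕ),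
      LocalDiffLE G (splitThresholdGraph X k g) (3 * (t * t) + 2 * t + 40 * t ^ 4) := by
  obtain ⟨X, hX, hY⟩ := hG.exists_split
  obtain ⟨k, g, hk, hg⟩ := exists_threshold_relation
    (fun (x : X) (y : (Xᶜ : Set V)) => G.Adj x y) t
    (fun x x' hne => hG.card_diff_subtype_le (S := Xᶜ) (fun h => h x.2) (fun h => h x'.2)
      (Subtype.coe_injective.ne hne))
    (fun y y' hne => by
      simpa only [G.adj_comm] using
        hG.card_diff_subtype_le (S := X) y.2 y'.2 (Subtype.coe_injective.ne hne))
  let k' : V → ℕ := fun v => if h : v ∈ X then k ⟨v, h⟩ else 0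
  let g' : V → ℕ := fun v => if h : v ∈ Xᶜ then g ⟨v, h⟩ else 0
  have hk' : ∀ x : X, k' x = k x := fun x => dif_pos x.2
  have hg' : ∀ y : (Xᶜ : Set V), g' y = g y := fun y => dif_pos y.2
  refine ⟨X, k', g', fun v => ?_⟩
  set H := splitThresholdGraph X k' g' with hH
  have hadj : ∀ (x : X) (y : (Xᶜ : Set V)), H.Adj x y ↔ k x < g y := by
    intro x y
    have hx := x.2
    have hy : (y : V) ∉ X := y.2
    have hne : (x : V) ≠ y := fun h => hy (h ▸ hx)
    rw [← hk', ← hg']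
    simp only [hH, splitThresholdGraph]
    tauto
  by_cases hv : v ∈ X
  · refine ncard_diff_add_ncard_diff_le G H v X _ _ ?_ ?_
    · refine (card_le_card ?_).trans (hX v hv)
      intro w hw
      simp only [mem_filter, mem_univ, true_and] at hw ⊢
      have hne : w ≠ v := by
        rintro rfl
        simp at hw
      have hHw : H.Adj v w := ⟨hne.symm, .inl ⟨hv, hw.1⟩⟩
      tauto
    · have h := card_filter_subtype Xᶜ fun w => ¬ (G.Adj v w ↔ H.Adj v w)
      refine (card_le_card fun w hw => ?_).trans
        ((h.symm.le.trans (card_le_card ?_)).trans ((card_union_le _ _).trans (hk ⟨v, hv⟩)))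
      · simpa using hw
      intro y hy
      have := hadj ⟨v, hv⟩ y
      simp only [mem_filter, mem_univ, true_and, mem_union] at hy ⊢
      rw [← not_lt, ← this]
      tauto
  · refine ncard_diff_add_ncard_diff_le G H v Xᶜ _ _ ?_ ?_
    · refine (card_le_card ?_).trans (hY v hv)
      intro w hw
      simp only [mem_filter, mem_univ, true_and, Set.mem_compl_iff] at hw ⊢
      have hHw : ¬ H.Adj v w := by
        rintro ⟨-, h⟩
        tauto
      tauto
    · have h := card_filter_subtype X fun w => ¬ (G.Adj v w ↔ H.Adj v w)
      refine (card_le_card fun w hw => ?_).trans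
        ((h.symm.le.trans (card_le_card ?_)).trans ((card_union_le _ _).trans (hg ⟨v, hv⟩)))
      · simpa using hw
      intro x hx
      have := hadj x ⟨v, hv⟩
      simp only [mem_filter, mem_univ, true_and, mem_union] at hx ⊢
      rw [← not_lt, ← this, G.adj_comm x v, H.adj_comm x v]
      tauto

end

theorem statement_15 {V : Type*} [Fintype V] (t : ℕ) (G : SimpleGraph V)
    (hG : IsTDominating G t) :
    ∃ H : SimpleGraph V, IsSplitHalfGraph H ∧ LocalDiffLE G H (646 * t ^ 4) := by
  obtain ⟨X, k, g, h⟩ := exists_splitThresholdGraph hG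
  refine ⟨_, isSplitHalfGraph_splitThresholdGraph X k g, fun v => (h v).trans ?_⟩
  have h₁ : t ≤ t ^ 4 := Nat.le_self_pow (by norm_num) t
  have h₂ : t * t ≤ t ^ 4 := by nlinarith [Nat.le_self_pow (n := 2) (by norm_num) (t * t)]
  omega
end

section
/- For every integer k ≥ 1 there exist finite disjoint sets A, B and a bipartite graph G with bipartition (A,B) that is 1-nested on (A,B), such that every bipartite graph H with the same bipartition (A,B) that is 0-nested on (A,B) (i.e., every half-graph on (A,B)) has bipartite local difference at least k from G. -/
/-- `G` is a bipartite graph with bipartition `(A, B)`: the parts cover the vertex set, are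
disjoint, and every edge goes between `A` and `B`. -/
def BipartiteOn {V : Type*} (G : SimpleGraph V) (A B : Set V) : Prop :=
  (∀ v, v ∈ A ∨ v ∈ B) ∧ Disjoint A B ∧
    ∀ x y, G.Adj x y → (x ∈ A ∧ y ∈ B) ∨ (x ∈ B ∧ y ∈ A)

/-- `G` is `t`-nested on `(A, B)`: for all distinct `u, v ∈ B`, one of them has at most `t`
neighbours (in `A`) that are nonadjacent to the other. -/
def TNested {V : Type*} (G : SimpleGraph V) (A B : Set V) (t : ℕ) : Prop :=
  ∀ u ∈ B, ∀ v ∈ B, u ≠ v →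
    {a : V | a ∈ A ∧ G.Adj u a ∧ ¬ G.Adj v a}.ncard ≤ t ∨
    {a : V | a ∈ A ∧ G.Adj v a ∧ ¬ G.Adj u a}.ncard ≤ t

/-- The bipartite graph on `α ⊕ β` in which `b : β` has neighbourhood `S b`. -/
def bipartiteOfSets {α β : Type} (S : β → Set α) : SimpleGraph (α ⊕ β) where
  Adj x y := (∃ a b, x = .inl a ∧ y = .inr b ∧ a ∈ S b) ∨
    (∃ a b, x = .inr b ∧ y = .inl a ∧ a ∈ S b)
  symm := ⟨by
    rintro x y (⟨a, b, rfl, rfl, h⟩ | ⟨a, b, rfl, rfl, h⟩)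
    · exact .inr ⟨a, b, rfl, rfl, h⟩
    · exact .inl ⟨a, b, rfl, rfl, h⟩⟩
  loopless := ⟨by
    rintro x (⟨a, b, rfl, h, -⟩ | ⟨a, b, rfl, h, -⟩) <;> cases h⟩

theorem bipartiteOfSets_adj {α β : Type} (S : β → Set α) (a : α) (b : β) :
    (bipartiteOfSets S).Adj (.inr b) (.inl a) ↔ a ∈ S b := by
  simp [bipartiteOfSets]

theorem bipartiteOn_bipartiteOfSets {α β : Type} (S : β → Set α) :
    BipartiteOn (bipartiteOfSets S) (Set.range .inl) (Set.range .inr) := by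
  refine ⟨?_, Set.isCompl_range_inl_range_inr.disjoint, ?_⟩
  · rintro (a | b) <;> simp
  · rintro x y (⟨a, b, rfl, rfl, h⟩ | ⟨a, b, rfl, rfl, h⟩) <;> simp

theorem ncard_range_inl_sep {α β : Type} (P : α ⊕ β → Prop) :
    {x : α ⊕ β | x ∈ Set.range Sum.inl ∧ P x}.ncard = {a : α | P (.inl a)}.ncard := by
  rw [← Set.ncard_image_of_injective _ (Sum.inl_injective (α := α) (β := β))]
  congr 1
  ext (a | b) <;> simp

/-- The ground set of the construction: nodes `(r, q)` of a binary tree, standing for the block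
of those `i` with `i / 2 ^ (r + 1) = q`, together with `2 * k` padding points for each index. -/
abbrev TreeGround (k : ℕ) : Type := (Fin k × Fin (2 ^ k)) ⊕ (Fin (2 ^ k) × Fin (2 * k))

/-- The `i`-th set of the construction. A node belongs to it if `i` lies after the block of the
node or in the left half of that block; a padding point belongs to it if its index is at
most `i`. -/
def treeSet (k : ℕ) (i : Fin (2 ^ k)) : Set (TreeGround k) :=
  {x | match x with
    | .inl (r, q) => (q : ℕ) < i / 2 ^ (r + 1 : ℕ) ∨
        ((i : ℕ) / 2 ^ (r + 1 : ℕ) = q ∧ (i : ℕ) / 2 ^ (r : ℕ) % 2 = 0)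
    | .inr (c, _) => c ≤ i}

theorem inl_mem_treeSet {k : ℕ} {i : Fin (2 ^ k)} {r : Fin k} {q : Fin (2 ^ k)} :
    (.inl (r, q) : TreeGround k) ∈ treeSet k i ↔ (q : ℕ) < i / 2 ^ (r + 1 : ℕ) ∨
      ((i : ℕ) / 2 ^ (r + 1 : ℕ) = q ∧ (i : ℕ) / 2 ^ (r : ℕ) % 2 = 0) := Iff.rfl

theorem inr_mem_treeSet {k : ℕ} {i c : Fin (2 ^ k)} {m : Fin (2 * k)} :
    (.inr (c, m) : TreeGround k) ∈ treeSet k i ↔ c ≤ i := Iff.rfl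

theorem Nat.div_two_pow_eq_of_le {i j r s : ℕ} (h : i / 2 ^ r = j / 2 ^ r) (hrs : r ≤ s) :
    i / 2 ^ s = j / 2 ^ s := by
  obtain ⟨d, rfl⟩ := Nat.exists_eq_add_of_le hrs
  rw [pow_add, ← Nat.div_div_eq_div_mul, ← Nat.div_div_eq_div_mul, h]

/-- Points lost when passing to a later set are nodes whose block is split by the two indices. -/
theorem exists_of_mem_treeSet_diff {k : ℕ} {i j : Fin (2 ^ k)} (hij : i < j) {x : TreeGround k}
    (hx : x ∈ treeSet k i \ treeSet k j) :
    ∃ r q, x = .inl (r, q) ∧ (i : ℕ) / 2 ^ (r + 1 : ℕ) = q ∧ (j : ℕ) / 2 ^ (r + 1 : ℕ) = q ∧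
      (i : ℕ) / 2 ^ (r : ℕ) ≠ (j : ℕ) / 2 ^ (r : ℕ) := by
  obtain ⟨hi, hj⟩ := hx
  rcases x with ⟨r, q⟩ | ⟨c, m⟩
  · rw [inl_mem_treeSet] at hi hj
    have hle : (i : ℕ) / 2 ^ (r + 1 : ℕ) ≤ (j : ℕ) / 2 ^ (r + 1 : ℕ) :=
      Nat.div_le_div_right hij.le
    refine ⟨r, q, rfl, by omega, by omega, fun h => ?_⟩
    rw [h] at hi
    omega
  · exact absurd (le_trans (inr_mem_treeSet.1 hi) hij.le) hj

theorem ncard_treeSet_diff_le_one {k : ℕ} {i j : Fin (2 ^ k)} (hij : i < j) :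
    (treeSet k i \ treeSet k j).ncard ≤ 1 := by
  rw [Set.ncard_le_one]
  intro x hx y hy
  obtain ⟨r, q, rfl, hi, hj, hne⟩ := exists_of_mem_treeSet_diff hij hx
  obtain ⟨r', q', rfl, hi', hj', hne'⟩ := exists_of_mem_treeSet_diff hij hy
  have hr : r = r' := by
    rcases lt_trichotomy r r' with h | h | h
    · exact absurd (Nat.div_two_pow_eq_of_le (hi.trans hj.symm) h) hne'
    · exact h
    · exact absurd (Nat.div_two_pow_eq_of_le (hi'.trans hj'.symm) h) hne
  subst hr
  rw [Fin.ext (hi.symm.trans hi')]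

theorem le_ncard_treeSet_diff {k : ℕ} {i j : Fin (2 ^ k)} (hij : i < j) :
    2 * k ≤ (treeSet k j \ treeSet k i).ncard := by
  have hinj : Function.Injective fun m : Fin (2 * k) => (.inr (j, m) : TreeGround k) := by
    intro a b h
    simpa using h
  calc 2 * k = (Set.range fun m : Fin (2 * k) => (.inr (j, m) : TreeGround k)).ncard := by
        rw [← Set.image_univ, Set.ncard_image_of_injective _ hinj, Set.ncard_univ]
        simp
    _ ≤ _ := by
        refine Set.ncard_le_ncard ?_
        rintro _ ⟨m, rfl⟩
        exact ⟨inr_mem_treeSet.2 le_rfl, fun h => absurd (inr_mem_treeSet.1 h) hij.not_ge⟩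

/-- Descending the binary tree, some block of each size consists of indices at which `T` differs
from `treeSet k` at all nodes above them. -/
theorem exists_block_errors {k : ℕ} {T : Fin (2 ^ k) → Set (TreeGround k)} (hT : Monotone T)
    (d : ℕ) (hd : d ≤ k) :
    ∃ q < 2 ^ d, ∀ i : Fin (2 ^ k), (i : ℕ) / 2 ^ (k - d) = q → ∀ r : Fin k, k - d ≤ r →
      ∃ p, ¬ ((.inl (r, p) : TreeGround k) ∈ treeSet k i ↔ .inl (r, p) ∈ T i) := by
  induction d with
  | zero => exact ⟨0, by simp, fun i _ r hr => by omega⟩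
  | succ d ih =>
    obtain ⟨q, hq, h⟩ := ih (by omega)
    obtain ⟨s, hs⟩ : ∃ s, s = k - (d + 1) := ⟨_, rfl⟩
    have hsd : k - d = s + 1 := by omega
    rw [hsd] at h
    rw [← hs]
    have hsk : s < k := by omega
    have hqk : q < 2 ^ k := hq.trans_le (Nat.pow_le_pow_right (by norm_num) (by omega))
    have hdiv (i : ℕ) : i / 2 ^ (s + 1) = i / 2 ^ s / 2 := by
      rw [pow_succ, Nat.div_div_eq_div_mul]
    have extend (q' : ℕ) (hq' : q' / 2 = q)
        (herr : ∀ i : Fin (2 ^ k), (i : ℕ) / 2 ^ s = q' →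
          ¬ ((.inl (⟨s, hsk⟩, ⟨q, hqk⟩) : TreeGround k) ∈ treeSet k i ↔
            .inl (⟨s, hsk⟩, ⟨q, hqk⟩) ∈ T i)) :
        ∃ q < 2 ^ (d + 1), ∀ i : Fin (2 ^ k), (i : ℕ) / 2 ^ s = q → ∀ r : Fin k, s ≤ r →
          ∃ p, ¬ ((.inl (r, p) : TreeGround k) ∈ treeSet k i ↔ .inl (r, p) ∈ T i) := by
      refine ⟨q', by rw [pow_succ]; omega, fun i hi r hr => ?_⟩
      rcases hr.eq_or_lt with hr | hr
      · obtain rfl : r = ⟨s, hsk⟩ := Fin.ext hr.symm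
        exact ⟨_, herr i hi⟩
      · exact h i (by rw [hdiv, hi, hq']) r hr
    by_cases hleft : ∀ i : Fin (2 ^ k), (i : ℕ) / 2 ^ s = 2 * q →
        (.inl (⟨s, hsk⟩, ⟨q, hqk⟩) : TreeGround k) ∉ T i
    · refine extend (2 * q) (by omega) fun i hi hiff => hleft i hi (hiff.1 ?_)
      rw [inl_mem_treeSet]
      simp only [hdiv, hi]
      omega
    · push Not at hleft
      obtain ⟨i, hi, hmem⟩ := hleft
      refine extend (2 * q + 1) (by omega) fun j hj hiff => ?_
      have hij : i ≤ j := by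
        by_contra hlt
        have : (j : ℕ) / 2 ^ s ≤ (i : ℕ) / 2 ^ s := Nat.div_le_div_right (not_le.1 hlt).le
        omega
      have hmem' := hiff.2 (hT hij hmem)
      rw [inl_mem_treeSet] at hmem'
      simp only [hdiv, hj] at hmem'
      omega

theorem exists_le_ncard_of_monotone {k : ℕ} {T : Fin (2 ^ k) → Set (TreeGround k)}
    (hT : Monotone T) :
    ∃ i, k ≤ (treeSet k i \ T i).ncard + (T i \ treeSet k i).ncard := by
  obtain ⟨q, hq, h⟩ := exists_block_errors hT k le_rfl
  choose p hp using fun r : Fin k => h ⟨q, hq⟩ (by simp) r (by omega)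
  refine ⟨⟨q, hq⟩, le_trans ?_ (Set.ncard_union_le _ _)⟩
  have hinj : Function.Injective fun r : Fin k => (.inl (r, p r) : TreeGround k) := by
    intro a b hab
    exact (Prod.ext_iff.1 (Sum.inl_injective hab)).1
  calc k = (Set.range fun r : Fin k => (.inl (r, p r) : TreeGround k)).ncard := by
        rw [← Set.image_univ, Set.ncard_image_of_injective _ hinj, Set.ncard_univ]
        simp
    _ ≤ _ := by
        refine Set.ncard_le_ncard ?_
        rintro _ ⟨r, rfl⟩
        have := hp r
        simp only [Set.mem_union, Set.mem_sdiff]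
        tauto

/-- No chain of sets is close to the family `treeSet k`. -/
theorem exists_le_ncard_of_chain {k : ℕ} {T : Fin (2 ^ k) → Set (TreeGround k)}
    (hT : ∀ i j, i ≠ j → T i ⊆ T j ∨ T j ⊆ T i) :
    ∃ i, k ≤ (treeSet k i \ T i).ncard + (T i \ treeSet k i).ncard := by
  by_contra! hlt
  have hmono : Monotone T := by
    refine monotone_iff_forall_lt.2 fun i j hij => (hT i j hij.ne).resolve_right fun hji => ?_
    have hsub : treeSet k j \ treeSet k i ⊆ (treeSet k j \ T j) ∪ (T i \ treeSet k i) := by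
      rintro x ⟨hxj, hxi⟩
      by_cases hx : x ∈ T j
      · exact .inr ⟨hji hx, hxi⟩
      · exact .inl ⟨hxj, hx⟩
    have h₁ := (le_ncard_treeSet_diff hij).trans
      ((Set.ncard_le_ncard hsub).trans (Set.ncard_union_le _ _))
    have h₂ := hlt i
    have h₃ := hlt j
    omega
  obtain ⟨i, hi⟩ := exists_le_ncard_of_monotone hmono
  exact absurd (hlt i) hi.not_gt

theorem statement_16 (k : ℕ) (hk : 1 ≤ k) :
    ∃ (V : Type) (_ : Fintype V) (A B : Set V) (G : SimpleGraph V),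
      BipartiteOn G A B ∧ TNested G A B 1 ∧
      ∀ H : SimpleGraph V, BipartiteOn H A B → TNested H A B 0 →
        ∃ v ∈ B,
          k ≤ {a : V | a ∈ A ∧ G.Adj v a ∧ ¬ H.Adj v a}.ncard +
              {a : V | a ∈ A ∧ H.Adj v a ∧ ¬ G.Adj v a}.ncard := by
  refine ⟨TreeGround k ⊕ Fin (2 ^ k), inferInstance, Set.range .inl, Set.range .inr,
    bipartiteOfSets (treeSet k), bipartiteOn_bipartiteOfSets _, ?_, ?_⟩
  · rintro _ ⟨i, rfl⟩ _ ⟨j, rfl⟩ hne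
    simp only [ncard_range_inl_sep, bipartiteOfSets_adj]
    rcases lt_or_gt_of_ne (fun h => hne (congrArg _ h) : i ≠ j) with h | h
    · exact .inl (ncard_treeSet_diff_le_one h)
    · exact .inr (ncard_treeSet_diff_le_one h)
  · intro H _ hH
    obtain ⟨i, hi⟩ := exists_le_ncard_of_chain (k := k)
      (T := fun i => {a | H.Adj (.inr i) (.inl a)}) fun i j hij => by
        have h := hH (.inr i) ⟨i, rfl⟩ (.inr j) ⟨j, rfl⟩ (by simpa using hij)
        simp only [ncard_range_inl_sep, Nat.le_zero] at h
        exact h.imp (fun h => Set.sdiff_eq_empty.1 ((Set.ncard_eq_zero (Set.toFinite _)).1 h))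
          fun h => Set.sdiff_eq_empty.1 ((Set.ncard_eq_zero (Set.toFinite _)).1 h)
    refine ⟨.inr i, ⟨i, rfl⟩, ?_⟩
    simp only [ncard_range_inl_sep, bipartiteOfSets_adj]
    exact hi
end

section
/- Let H₁ and H₂ be threshold graphs with |V(H₁)| + |V(H₂)| = m and ω(H₁) + α(H₂) = k. Then for every graph G that has no induced subgraph isomorphic to H₁ and no induced subgraph isomorphic to H₂, we have |V(G)| ≤ (2^m − 1)·ρ(G)^{k−2}, where ρ(G) = max(ω(G), α(G)). -/
/-- `G` is a threshold graph: it can be built from the null graph by repeatedly adding either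
an isolated vertex or a vertex adjacent to all current vertices; equivalently, the vertices
can be enumerated so that each vertex is isolated or universal among the earlier ones. -/
def IsThresholdGraph {V : Type*} [Fintype V] (G : SimpleGraph V) : Prop :=
  ∃ e : Fin (Fintype.card V) ≃ V,
    ∀ i : Fin (Fintype.card V),
      (∀ j, j < i → ¬ G.Adj (e j) (e i)) ∨ (∀ j, j < i → G.Adj (e j) (e i))

/-- The clique number `ω(G)`: the largest cardinality of a clique of `G`. -/
noncomputable def cliqueNumber {V : Type*} [Fintype V] (G : SimpleGraph V) : ℕ :=
  sSup {n : ℕ | ∃ S : Finset V, G.IsNClique n S}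

/-- The stability number `α(G)`: the largest cardinality of a stable set of `G`. -/
noncomputable def stabilityNumber {V : Type*} [Fintype V] (G : SimpleGraph V) : ℕ :=
  cliqueNumber Gᶜ

/-- `ρ(G) = max(ω(G), α(G))`. -/
noncomputable def rho {V : Type*} [Fintype V] (G : SimpleGraph V) : ℕ :=
  max (cliqueNumber G) (stabilityNumber G)

open Finset

/-- `S` contains an induced copy in `G` of the threshold graph with `n` vertices in which vertex
`i` is universal (if `c i`) or isolated (if not) among the earlier ones. -/
def ContainsThreshold {V : Type*} (G : SimpleGraph V) (c : ℕ → Bool) (n : ℕ)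
    (S : Finset V) : Prop :=
  ∃ f : ℕ → V, (∀ i < n, f i ∈ S) ∧
    ∀ i < n, ∀ j < i, f i ≠ f j ∧ (G.Adj (f i) (f j) ↔ c i = true)

/-- The clique number of the threshold graph on `n` vertices with code `c`. -/
def codeCliqueNumber (c : ℕ → Bool) : ℕ → ℕ
  | 0 => 0
  | n + 1 => if c n then codeCliqueNumber c n + 1 else max 1 (codeCliqueNumber c n)

theorem one_le_codeCliqueNumber (c : ℕ → Bool) {n : ℕ} (hn : 0 < n) :
    1 ≤ codeCliqueNumber c n := by
  obtain ⟨n, rfl⟩ := Nat.exists_eq_succ_of_ne_zero hn.ne'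
  simp only [codeCliqueNumber]
  split_ifs <;> omega

theorem ContainsThreshold.zero {V : Type*} (G : SimpleGraph V) (c : ℕ → Bool) {S : Finset V}
    (hS : S.Nonempty) : ContainsThreshold G c 0 S := by
  obtain ⟨v, -⟩ := hS
  exact ⟨fun _ => v, by simp, by simp⟩

theorem ContainsThreshold.succ {V : Type*} {G : SimpleGraph V} {c : ℕ → Bool} {n : ℕ}
    {S T : Finset V} {v : V} (hv : v ∈ S) (hTS : T ⊆ S)
    (hT : ∀ w ∈ T, v ≠ w ∧ (G.Adj v w ↔ c n = true))
    (h : ContainsThreshold G c n T) : ContainsThreshold G c (n + 1) S := by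
  obtain ⟨f, hf, hfa⟩ := h
  refine ⟨Function.update f n v, fun i hi => ?_, fun i hi j hj => ?_⟩
  · rcases Nat.lt_succ_iff_lt_or_eq.mp hi with hi | rfl
    · simpa [Function.update_of_ne hi.ne] using hTS (hf i hi)
    · simpa using hv
  · rcases Nat.lt_succ_iff_lt_or_eq.mp hi with hi | rfl
    · simpa [Function.update_of_ne hi.ne, Function.update_of_ne (hj.trans hi).ne]
        using hfa i hi j hj
    · simpa [Function.update_of_ne hj.ne] using hT _ (hf j hj)

theorem ContainsThreshold.one {V : Type*} (G : SimpleGraph V) (c : ℕ → Bool) {S : Finset V}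
    (hS : S.Nonempty) : ContainsThreshold G c 1 S := by
  obtain ⟨v, hv⟩ := hS
  exact ⟨fun _ => v, fun _ _ => hv, fun i hi j hj => by omega⟩

/-- A set in which all degrees are at most `d` has a stable subset of at least a `d + 1`-th of
its size. -/
theorem exists_stable_of_degree_le {V : Type*} [DecidableEq V] (G : SimpleGraph V)
    [DecidableRel G.Adj] (d : ℕ) (S : Finset V)
    (hd : ∀ v ∈ S, #{w ∈ S | G.Adj v w} ≤ d) :
    ∃ T ⊆ S, Gᶜ.IsClique T ∧ #S ≤ #T * (d + 1) := by
  induction S using Finset.strongInduction with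
  | H S ih =>
    rcases S.eq_empty_or_nonempty with rfl | ⟨v, hv⟩
    · exact ⟨∅, by simp⟩
    set N := {w ∈ S | G.Adj v w} with hN
    have hvN : v ∉ N := by simp [hN]
    have hNS : insert v N ⊆ S := insert_subset hv (filter_subset _ _)
    have hsub : S \ insert v N ⊂ S :=
      sdiff_ssubset hNS (insert_nonempty _ _)
    obtain ⟨T, hTS, hT, hcard⟩ := ih _ hsub fun w hw =>
      (card_le_card (filter_subset_filter _ hsub.subset)).trans (hd w (hsub.subset hw))
    have hvT : v ∉ T := fun h => by simpa using hTS h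
    refine ⟨insert v T, insert_subset hv (hTS.trans hsub.subset), ?_, ?_⟩
    · rw [coe_insert, SimpleGraph.isClique_insert]
      refine ⟨hT, fun w hw hvw => ?_⟩
      have := hTS hw
      simp only [hN, mem_sdiff, mem_insert, mem_filter, not_or, not_and] at this
      exact (SimpleGraph.compl_adj _ _ _).mpr ⟨hvw, this.2.2 this.1⟩
    · have h₁ := card_sdiff_add_card_eq_card hNS
      have h₂ : #N ≤ d := hd v hv
      rw [card_insert_of_notMem hvN] at h₁
      rw [card_insert_of_notMem hvT, add_mul, one_mul]
      omega

theorem card_le_of_degree_le {V : Type*} [DecidableEq V] (G : SimpleGraph V)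
    [DecidableRel G.Adj] {r p q m : ℕ} {S : Finset V} (hr : 0 < r)
    (hst : ∀ T : Finset V, Gᶜ.IsClique T → #T ≤ r)
    (hd : ∀ v ∈ S, #{w ∈ S | G.Adj v w} ≤ (2 ^ m - 1) * r ^ p) (hq : q = p + 1) :
    #S ≤ (2 ^ (m + 1) - 1) * r ^ q := by
  obtain ⟨T, -, hT, hcard⟩ := exists_stable_of_degree_le G _ S hd
  have h1 : 1 ≤ r ^ p := Nat.one_le_pow _ _ hr
  have h2 : 1 ≤ 2 ^ m := Nat.one_le_two_pow
  calc #S ≤ r * ((2 ^ m - 1) * r ^ p + 1) := hcard.trans (Nat.mul_le_mul_right _ (hst T hT))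
    _ ≤ r * ((2 ^ m - 1) * r ^ p + r ^ p) := by gcongr
    _ = ((2 ^ m - 1) + 1) * r ^ q := by rw [hq]; ring
    _ ≤ (2 ^ (m + 1) - 1) * r ^ q := by
      gcongr
      rw [pow_succ]
      omega

theorem card_le_of_not_containsThreshold {V : Type*} (G : SimpleGraph V) (c d : ℕ → Bool)
    {r : ℕ} (hr : 0 < r) (hcl : ∀ T : Finset V, G.IsClique T → #T ≤ r)
    (hst : ∀ T : Finset V, Gᶜ.IsClique T → #T ≤ r) (a b : ℕ) (S : Finset V)
    (hc : ¬ ContainsThreshold G c a S) (hd : ¬ ContainsThreshold Gᶜ d b S) :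
    #S ≤ (2 ^ (a + b) - 1) * r ^ (codeCliqueNumber c a + codeCliqueNumber d b - 2) := by
  classical
  induction hN : a + b generalizing a b S with
  | zero =>
    rcases S.eq_empty_or_nonempty with rfl | hS
    · simp
    obtain rfl : a = 0 := by omega
    exact absurd (.zero G c hS) hc
  | succ N ih =>
    rcases S.eq_empty_or_nonempty with rfl | hS
    · simp
    match a, b with
    | 0, _ => exact absurd (.zero G c hS) hc
    | 1, _ => exact absurd (.one G c hS) hc
    | _, 0 => exact absurd (.zero Gᶜ d hS) hd
    | _, 1 => exact absurd (.one Gᶜ d hS) hd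
    | a + 2, b + 2 =>
    have hc1 := one_le_codeCliqueNumber c (n := a + 1) (by omega)
    have hd1 := one_le_codeCliqueNumber d (n := b + 1) (by omega)
    have hc2 : codeCliqueNumber c (a + 2) = if c (a + 1) then codeCliqueNumber c (a + 1) + 1
      else max 1 (codeCliqueNumber c (a + 1)) := rfl
    have hd2 : codeCliqueNumber d (b + 2) = if d (b + 1) then codeCliqueNumber d (b + 1) + 1
      else max 1 (codeCliqueNumber d (b + 1)) := rfl
    have hc3 := one_le_codeCliqueNumber c (n := a + 2) (by omega)
    have hd3 := one_le_codeCliqueNumber d (n := b + 2) (by omega)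
    have boundc : ∀ v ∈ S, ∀ T ⊆ S, (∀ w ∈ T, v ≠ w ∧ (G.Adj v w ↔ c (a + 1) = true)) →
        #T ≤ (2 ^ N - 1) *
          r ^ (codeCliqueNumber c (a + 1) + codeCliqueNumber d (b + 2) - 2) :=
      fun v hv T hTS hT => ih (a + 1) (b + 2) T (fun h => hc (.succ hv hTS hT h))
        (fun ⟨f, hf, hfa⟩ => hd ⟨f, fun i hi => hTS (hf i hi), hfa⟩) (by omega)
    have boundd : ∀ v ∈ S, ∀ T ⊆ S, (∀ w ∈ T, v ≠ w ∧ (Gᶜ.Adj v w ↔ d (b + 1) = true)) →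
        #T ≤ (2 ^ N - 1) *
          r ^ (codeCliqueNumber c (a + 2) + codeCliqueNumber d (b + 1) - 2) :=
      fun v hv T hTS hT => ih (a + 2) (b + 1) T
        (fun ⟨f, hf, hfa⟩ => hc ⟨f, fun i hi => hTS (hf i hi), hfa⟩)
        (fun h => hd (.succ hv hTS hT h)) (by omega)
    by_cases hca : c (a + 1) = true
    · rw [if_pos hca] at hc2
      refine card_le_of_degree_le G hr hst (fun v hv => boundc v hv _ (filter_subset _ _) ?_)
        (by omega)
      intro w hw
      have hvw := (mem_filter.mp hw).2
      exact ⟨hvw.ne, by simp [hvw, hca]⟩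
    by_cases hdb : d (b + 1) = true
    · rw [if_pos hdb] at hd2
      refine card_le_of_degree_le Gᶜ hr (by simpa using hcl)
        (fun v hv => boundd v hv _ (filter_subset _ _) ?_) (by omega)
      intro w hw
      have hvw := (mem_filter.mp hw).2
      exact ⟨hvw.ne, by simp only [hvw, hdb]⟩
    rw [if_neg hca, max_eq_right hc1] at hc2
    rw [if_neg hdb, max_eq_right hd1] at hd2
    obtain ⟨v, hv⟩ := hS
    have hA := boundc v hv {w ∈ S.erase v | ¬ G.Adj v w}
      ((filter_subset _ _).trans (erase_subset _ _)) fun w hw => by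
        obtain ⟨h, hvw⟩ := mem_filter.mp hw
        exact ⟨(ne_of_mem_erase h).symm, by simp [hvw, hca]⟩
    have hB := boundd v hv {w ∈ S.erase v | G.Adj v w}
      ((filter_subset _ _).trans (erase_subset _ _)) fun w hw => by
        obtain ⟨h, hvw⟩ := mem_filter.mp hw
        exact ⟨(ne_of_mem_erase h).symm, by simp [SimpleGraph.compl_adj, hvw, hdb]⟩
    have hsum := card_filter_add_card_filter_not (s := S.erase v) (fun w => G.Adj v w)
    have hS' := card_erase_add_one hv
    rw [← hc2] at hA
    rw [← hd2] at hB
    set x := r ^ (codeCliqueNumber c (a + 2) + codeCliqueNumber d (b + 2) - 2)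
    have hx : 1 ≤ x := Nat.one_le_pow _ _ hr
    have h2 : 1 ≤ 2 ^ N := Nat.one_le_two_pow
    calc #S ≤ (2 ^ N - 1) * x + (2 ^ N - 1) * x + x := by omega
      _ = (2 ^ (N + 1) - 1) * x := by
        obtain ⟨y, hy⟩ := Nat.exists_eq_add_of_le h2
        rw [pow_succ, hy, show (1 + y) * 2 - 1 = 2 * y + 1 by omega, Nat.add_sub_cancel_left]
        ring

theorem card_le_cliqueNumber {V : Type*} [Fintype V] (G : SimpleGraph V) {T : Finset V}
    (hT : G.IsClique T) : #T ≤ cliqueNumber G := by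
  refine le_csSup ⟨Fintype.card V, ?_⟩ ⟨T, hT, rfl⟩
  rintro n ⟨S, hS⟩
  exact hS.card_eq ▸ card_le_univ S

/-- A graph whose vertices are enumerated according to the code `c`. -/
def HasThresholdCode {V : Type*} {n : ℕ} (H : SimpleGraph V) (e : Fin n ≃ V)
    (c : ℕ → Bool) : Prop :=
  ∀ i j : Fin n, j < i → (H.Adj (e i) (e j) ↔ c i = true)

theorem IsThresholdGraph.exists_code {V : Type*} [Fintype V] {H : SimpleGraph V}
    (h : IsThresholdGraph H) :
    ∃ (e : Fin (Fintype.card V) ≃ V) (c : ℕ → Bool), HasThresholdCode H e c := by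
  classical
  obtain ⟨e, he⟩ := h
  refine ⟨e, fun i => decide (∃ hi : i < Fintype.card V, ∀ j, j < ⟨i, hi⟩ →
    H.Adj (e j) (e ⟨i, hi⟩)), fun i j hj => ?_⟩
  rw [decide_eq_true_iff, H.adj_comm]
  refine ⟨fun hadj => ⟨i.2, ?_⟩, fun ⟨_, h⟩ => h j hj⟩
  exact (he i).resolve_left fun h => h j hj hadj

theorem HasThresholdCode.compl {V : Type*} {n : ℕ} {H : SimpleGraph V} {e : Fin n ≃ V}
    {c : ℕ → Bool} (h : HasThresholdCode H e c) : HasThresholdCode Hᶜ e fun i => !c i := by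
  intro i j hj
  simp [SimpleGraph.compl_adj, h i j hj, hj.ne']

theorem HasThresholdCode.codeCliqueNumber_le {V : Type*} [Fintype V] {n : ℕ}
    {H : SimpleGraph V} {e : Fin n ≃ V} {c : ℕ → Bool} (h : HasThresholdCode H e c) :
    codeCliqueNumber c n ≤ cliqueNumber H := by
  classical
  have key : ∀ k ≤ n, ∃ T : Finset V, H.IsClique T ∧ #T = codeCliqueNumber c k ∧
      ∀ v ∈ T, (e.symm v : ℕ) < k := by
    intro k
    induction k with
    | zero => exact fun _ => ⟨∅, by simp [codeCliqueNumber]⟩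
    | succ k ih =>
      intro hk
      obtain ⟨T, hT, hcard, hlt⟩ := ih (by omega)
      by_cases hck : c k = true
      · have hnot : e ⟨k, hk⟩ ∉ T := fun hmem => by simpa using hlt _ hmem
        refine ⟨insert (e ⟨k, hk⟩) T, ?_, ?_, ?_⟩
        · rw [coe_insert, SimpleGraph.isClique_insert]
          refine ⟨hT, fun w hw _ => ?_⟩
          simpa [hck] using h ⟨k, hk⟩ (e.symm w) (hlt w hw)
        · rw [card_insert_of_notMem hnot, hcard, codeCliqueNumber, if_pos hck]
        · intro v hv
          rcases mem_insert.mp hv with rfl | hv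
          · simp
          · exact (hlt v hv).trans (Nat.lt_succ_self k)
      · rw [codeCliqueNumber, if_neg hck]
        rcases Nat.eq_zero_or_pos (codeCliqueNumber c k) with h0 | h0
        · refine ⟨{e ⟨k, hk⟩}, by simp, by simp [h0], by simp⟩
        · exact ⟨T, hT, by omega, fun v hv => (hlt v hv).trans (Nat.lt_succ_self k)⟩
  obtain ⟨T, hT, hcard, -⟩ := key n le_rfl
  exact hcard ▸ card_le_cliqueNumber H hT

theorem HasThresholdCode.nonempty_embedding {V W : Type*} {n : ℕ} {H : SimpleGraph V}
    {G : SimpleGraph W} {e : Fin n ≃ V} {c : ℕ → Bool} (h : HasThresholdCode H e c)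
    {S : Finset W} (hS : ContainsThreshold G c n S) : Nonempty (H ↪g G) := by
  obtain ⟨f, -, hf⟩ := hS
  refine ⟨⟨⟨fun v => f (e.symm v), fun v w hvw => ?_⟩, fun {v w} => ?_⟩⟩
  · obtain ⟨i, rfl⟩ := e.surjective v
    obtain ⟨j, rfl⟩ := e.surjective w
    simp only [Equiv.symm_apply_apply] at hvw
    rcases lt_trichotomy i j with hij | rfl | hij
    · exact absurd hvw.symm (hf j j.2 i hij).1
    · rfl
    · exact absurd hvw (hf i i.2 j hij).1
  · obtain ⟨i, rfl⟩ := e.surjective v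
    obtain ⟨j, rfl⟩ := e.surjective w
    change G.Adj (f (e.symm (e i))) (f (e.symm (e j))) ↔ _
    simp only [Equiv.symm_apply_apply]
    rcases lt_trichotomy i j with hij | rfl | hij
    · rw [G.adj_comm, H.adj_comm, h j i hij, (hf j j.2 i hij).2]
    · simp
    · rw [h i j hij, (hf i i.2 j hij).2]

theorem statement_19 {V₁ V₂ V : Type*} [Fintype V₁] [Fintype V₂] [Fintype V]
    (H₁ : SimpleGraph V₁) (H₂ : SimpleGraph V₂) (G : SimpleGraph V) (m k : ℕ)
    (h₁ : IsThresholdGraph H₁) (h₂ : IsThresholdGraph H₂)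
    (hm : Fintype.card V₁ + Fintype.card V₂ = m)
    (hk : cliqueNumber H₁ + stabilityNumber H₂ = k)
    (hG₁ : ¬ Nonempty (H₁ ↪g G)) (hG₂ : ¬ Nonempty (H₂ ↪g G)) :
    Fintype.card V ≤ (2 ^ m - 1) * rho G ^ (k - 2) := by
  rcases isEmpty_or_nonempty V with hV | ⟨⟨v⟩⟩
  · simp
  obtain ⟨e₁, c, hc⟩ := h₁.exists_code
  obtain ⟨e₂, d, hd⟩ := h₂.exists_code
  have hcl : ∀ T : Finset V, G.IsClique T → #T ≤ rho G := fun T hT =>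
    (card_le_cliqueNumber G hT).trans (le_max_left _ _)
  have hst : ∀ T : Finset V, Gᶜ.IsClique T → #T ≤ rho G := fun T hT =>
    (card_le_cliqueNumber Gᶜ hT).trans (le_max_right _ _)
  have hr : 0 < rho G := Nat.lt_of_lt_of_le (by simp) (hcl {v} (by simp))
  have hembed : ¬ ContainsThreshold Gᶜ (fun i => !d i) (Fintype.card V₂) univ := fun h => by
    obtain ⟨φ⟩ := hd.compl.nonempty_embedding h
    refine hG₂ ⟨⟨φ.toEmbedding, fun {x y} => ?_⟩⟩
    have := φ.map_adj_iff (v := x) (w := y)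
    rw [SimpleGraph.compl_adj, SimpleGraph.compl_adj, φ.injective.ne_iff] at this
    by_cases hxy : x = y
    · simp [hxy]
    · simpa [hxy, not_iff_not] using this
  have hmain := card_le_of_not_containsThreshold G c (fun i => !d i) hr hcl hst
    (Fintype.card V₁) (Fintype.card V₂) univ (fun h => hG₁ (hc.nonempty_embedding h)) hembed
  rw [card_univ, hm] at hmain
  refine hmain.trans (Nat.mul_le_mul_left _ (Nat.pow_le_pow_right hr ?_))
  have h3 := hc.codeCliqueNumber_le
  have h4 : codeCliqueNumber (fun i => !d i) (Fintype.card V₂) ≤ stabilityNumber H₂ :=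
    hd.compl.codeCliqueNumber_le
  omega
end
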